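/- Let n ≥ 5 be an integer and let G be the grid P_n □ P_5. Then the strong convexity spectrum of G equals S_SC(G) = {k ∈ ℤ : 1 ≤ k ≤ 5n−5} \ {2, 3, 5}. -/

import Mathlib

/-!  Common definitions: oriented graphs, geodesic convexity, convexity number,
strong convexity spectrum, and grid graphs. -/

variable {V : Type*}

/-- A directed walk of length `k` from `u` to `v` along the arc relation `A`,
encoded by the function `f` listing its vertices. -/
def IsDirWalk (A : V → V → Prop) (k : ℕ) (f : ℕ → V) (u v : V) : Prop :=
  f 0 = u ∧ f k = v ∧ ∀ i, i < k → A (f i) (f (i + 1))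

/-- There is a directed walk from `u` to `v`. -/
def DirReachable (A : V → V → Prop) (u v : V) : Prop :=
  ∃ k f, IsDirWalk A k f u v

/-- A digraph (given by its arc relation) is strongly connected. -/
def StrongConnected (A : V → V → Prop) : Prop :=
  ∀ u v : V, DirReachable A u v

/-- A `uv`-geodesic: a directed walk from `u` to `v` of minimum possible length
(such a walk is automatically a directed path). -/
def IsGeodesic (A : V → V → Prop) (k : ℕ) (f : ℕ → V) (u v : V) : Prop :=
  IsDirWalk A k f u v ∧ ∀ k' f', IsDirWalk A k' f' u v → k ≤ k'

/-- A nonempty vertex set `C` is convex if every vertex lying on a geodesic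
between two vertices of `C` (in either direction) belongs to `C`. -/
def DConvex (A : V → V → Prop) (C : Set V) : Prop :=
  C.Nonempty ∧ ∀ u ∈ C, ∀ v ∈ C, ∀ k f, IsGeodesic A k f u v → ∀ i ≤ k, f i ∈ C

/-- `A` is an orientation of the simple graph `G`: every arc is along an edge,
every edge gets an arc, and no edge gets both directions. -/
def IsOrientation (G : SimpleGraph V) (A : V → V → Prop) : Prop :=
  (∀ x y, A x y → G.Adj x y) ∧ (∀ x y, G.Adj x y → A x y ∨ A y x) ∧
    (∀ x y, A x y → ¬ A y x)

/-- The convexity number of a digraph: the maximum cardinality of a proper convex set. -/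
noncomputable def convexityNumber [Fintype V] (A : V → V → Prop) : ℕ :=
  sSup {k | ∃ C : Set V, DConvex A C ∧ C ≠ Set.univ ∧ C.ncard = k}

/-- The strong convexity spectrum of a graph: the set of convexity numbers of
its strongly connected orientations. -/
def strongConvexitySpectrum [Fintype V] (G : SimpleGraph V) : Set ℕ :=
  {k | ∃ A : V → V → Prop, IsOrientation G A ∧ StrongConnected A ∧ convexityNumber A = k}

/-- The grid graph `P_n □ P_m`. -/
def gridGraph (n m : ℕ) : SimpleGraph (Fin n × Fin m) :=
  (SimpleGraph.pathGraph n).boxProd (SimpleGraph.pathGraph m)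

section

variable {V : Type*}

/-! ### Walks as a relation -/

/-- There is a walk of length `k` from `x` to `y`. -/
def WalkRel (A : V → V → Prop) : ℕ → V → V → Prop
  | 0, x, y => x = y
  | k + 1, x, y => ∃ z, A x z ∧ WalkRel A k z y

theorem walkRel_add {A : V → V → Prop} {i j : ℕ} {x y z : V}
    (h1 : WalkRel A i x y) (h2 : WalkRel A j y z) : WalkRel A (i + j) x z := by
  induction i generalizing x with
  | zero => cases h1; simpa using h2
  | succ i ih =>
    obtain ⟨w, hw, h⟩ := h1
    have := ih h
    rw [show i + 1 + j = (i + j) + 1 by omega]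
    exact ⟨w, hw, this⟩

theorem walkRel_one {A : V → V → Prop} {x y : V} (h : A x y) : WalkRel A 1 x y := ⟨y, h, rfl⟩

theorem walkRel_snoc {A : V → V → Prop} {k : ℕ} {x y z : V}
    (h1 : WalkRel A k x y) (h2 : A y z) : WalkRel A (k + 1) x z :=
  walkRel_add h1 (walkRel_one h2)

theorem walkRel_unsnoc {A : V → V → Prop} {k : ℕ} {x z : V}
    (h : WalkRel A (k + 1) x z) : ∃ y, WalkRel A k x y ∧ A y z := by
  induction k generalizing x with
  | zero =>
    obtain ⟨w, hw, h⟩ := h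
    cases h
    exact ⟨x, rfl, hw⟩
  | succ k ih =>
    obtain ⟨w, hw, h⟩ := h
    obtain ⟨y, hy, h2⟩ := ih h
    exact ⟨y, ⟨w, hw, hy⟩, h2⟩

theorem walkRel_flip {A : V → V → Prop} {k : ℕ} {x y : V} :
    WalkRel (flip A) k x y ↔ WalkRel A k y x := by
  induction k generalizing x with
  | zero => exact eq_comm
  | succ k ih =>
    constructor
    · rintro ⟨z, hz, h⟩
      exact walkRel_snoc (ih.1 h) hz
    · intro h
      obtain ⟨z, hz, h⟩ := walkRel_unsnoc h
      exact ⟨z, h, ih.2 hz⟩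

theorem walkRel_of_dirWalk {A : V → V → Prop} (f : ℕ → V) (k a : ℕ)
    (h : ∀ i, a ≤ i → i < a + k → A (f i) (f (i + 1))) : WalkRel A k (f a) (f (a + k)) := by
  induction k with
  | zero => rfl
  | succ k ih =>
    refine walkRel_snoc (ih fun i h1 h2 => h i h1 (by omega)) ?_
    exact h (a + k) (by omega) (by omega)

theorem exists_dirWalk {A : V → V → Prop} {k : ℕ} {x y : V} (h : WalkRel A k x y) :
    ∃ f, IsDirWalk A k f x y := by
  induction k generalizing x with
  | zero => exact ⟨fun _ => x, rfl, h, by intro i hi; omega⟩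
  | succ k ih =>
    obtain ⟨z, hz, h⟩ := h
    obtain ⟨f, h0, hk, hf⟩ := ih h
    refine ⟨fun i => if i = 0 then x else f (i - 1), by simp, by simpa using hk, ?_⟩
    intro i hi
    rcases Nat.eq_zero_or_pos i with rfl | hp
    · simpa [h0] using hz
    · have := hf (i - 1) (by omega)
      rw [show i - 1 + 1 = i by omega] at this
      simpa [show i ≠ 0 by omega] using this

theorem dirWalk_iff {A : V → V → Prop} {k : ℕ} {x y : V} :
    WalkRel A k x y ↔ ∃ f, IsDirWalk A k f x y := by
  refine ⟨exists_dirWalk, ?_⟩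
  rintro ⟨f, h0, hk, hf⟩
  have := walkRel_of_dirWalk (A := A) f k 0 (fun i _ h => hf i (by omega))
  rw [h0, Nat.zero_add, hk] at this
  exact this

/-- Closedness under geodesics, in terms of walks. -/
def GeoClosed (A : V → V → Prop) (C : Set V) : Prop :=
  ∀ u ∈ C, ∀ v ∈ C, ∀ p i j, WalkRel A i u p → WalkRel A j p v →
    (∀ k, WalkRel A k u v → i + j ≤ k) → p ∈ C

theorem dconvex_iff {A : V → V → Prop} {C : Set V} :
    DConvex A C ↔ C.Nonempty ∧ GeoClosed A C := by
  refine and_congr_right fun _ => ⟨?_, ?_⟩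
  · intro h u hu v hv p i j h1 h2 hmin
    obtain ⟨f, f0, fi, hf⟩ := exists_dirWalk h1
    obtain ⟨g, g0, gj, hg⟩ := exists_dirWalk h2
    have key := h u hu v hv (i + j) (fun t => if t ≤ i then f t else g (t - i)) ?_ i (by omega)
    · simpa [fi] using key
    · refine ⟨⟨by simp [f0], ?_, ?_⟩, ?_⟩
      · by_cases hj : j = 0
        · subst hj
          simp [fi]
          rw [← gj, g0]
        · simp [hj, gj]
      · intro t ht
        by_cases h3 : t + 1 ≤ i
        · simpa [h3, show t ≤ i by omega] using hf t (by omega)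
        · by_cases h4 : t ≤ i
          · have : t = i := by omega
            subst this
            have := hg 0 (by omega)
            simpa [fi, g0] using this
          · have := hg (t - i) (by omega)
            simpa [h3, h4, show t + 1 - i = t - i + 1 by omega] using this
      · intro k' f' hf'
        exact hmin k' (dirWalk_iff.2 ⟨f', hf'⟩)
  · intro h u hu v hv k f hf i hi
    obtain ⟨⟨h0, hk, hf⟩, hmin⟩ := hf
    refine h u hu v hv (f i) i (k - i) ?_ ?_ ?_
    · have := walkRel_of_dirWalk (A := A) f i 0 (fun t _ h => hf t (by omega))
      simpa [h0] using this
    · have := walkRel_of_dirWalk (A := A) f (k - i) i (fun t _ h => hf t (by omega))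
      rwa [show i + (k - i) = k by omega, hk] at this
    · intro k' hk'
      obtain ⟨f', hf'⟩ := exists_dirWalk hk'
      have := hmin k' f' hf'
      omega

theorem geoClosed_flip {A : V → V → Prop} {C : Set V} (h : GeoClosed A C) :
    GeoClosed (flip A) C := by
  intro u hu v hv p i j h1 h2 hmin
  refine h v hv u hu p j i (walkRel_flip.1 h2) (walkRel_flip.1 h1) ?_
  intro k hk
  have := hmin k (walkRel_flip.2 hk)
  omega

theorem geoClosed_flip_iff {A : V → V → Prop} {C : Set V} :
    GeoClosed (flip A) C ↔ GeoClosed A C :=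
  ⟨fun h => geoClosed_flip h, geoClosed_flip⟩

/-- Strong connectedness in terms of walks. -/
def StrongW (A : V → V → Prop) : Prop := ∀ u v, ∃ k, WalkRel A k u v

theorem strongConnected_iff {A : V → V → Prop} : StrongConnected A ↔ StrongW A := by
  refine forall_congr' fun u => forall_congr' fun v => exists_congr fun k => ?_
  exact dirWalk_iff.symm

theorem strongW_flip {A : V → V → Prop} (h : StrongW A) : StrongW (flip A) := fun u v =>
  (h v u).imp fun _ => walkRel_flip.2

/-- In a strong digraph there are geodesics. -/
theorem exists_min_walk {A : V → V → Prop} (h : StrongW A) (u v : V) :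
    ∃ k, WalkRel A k u v ∧ ∀ k', WalkRel A k' u v → k ≤ k' := by
  classical
  exact ⟨Nat.find (h u v), Nat.find_spec (h u v), fun k' hk => Nat.find_min' _ hk⟩

/-- A closed set with a second element contains an out-neighbour of each of its elements. -/
theorem geoClosed_out {A : V → V → Prop} (hs : StrongW A) {C : Set V} (hC : GeoClosed A C)
    {x y : V} (hx : x ∈ C) (hy : y ∈ C) (hxy : x ≠ y) : ∃ z ∈ C, A x z := by
  obtain ⟨k, hk, hmin⟩ := exists_min_walk hs x y
  cases k with
  | zero => exact absurd hk hxy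
  | succ k =>
    obtain ⟨z, hz, hw⟩ := hk
    refine ⟨z, hC x hx y hy z 1 k (walkRel_one hz) hw ?_, hz⟩
    intro k' hk'
    have := hmin k' hk'
    omega

theorem geoClosed_in {A : V → V → Prop} (hs : StrongW A) {C : Set V} (hC : GeoClosed A C)
    {x y : V} (hx : x ∈ C) (hy : y ∈ C) (hxy : x ≠ y) : ∃ z ∈ C, A z x :=
  geoClosed_out (strongW_flip hs) (geoClosed_flip hC) hx hy hxy

/-- `k` is the largest size of a proper closed set. -/
structure MaxClosed (A : V → V → Prop) (k : ℕ) : Prop where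
  pos : 1 ≤ k
  ex : ∃ S : Set V, GeoClosed A S ∧ S ≠ Set.univ ∧ S.ncard = k
  le : ∀ C : Set V, GeoClosed A C → C ≠ Set.univ → C.ncard ≤ k

theorem convexityNumber_eq [Fintype V] {A : V → V → Prop} {k : ℕ} (h : MaxClosed A k) :
    convexityNumber A = k := by
  apply IsGreatest.csSup_eq
  constructor
  · obtain ⟨S, h1, h2, h3⟩ := h.ex
    refine ⟨S, dconvex_iff.2 ⟨?_, h1⟩, h2, h3⟩
    have := h.pos
    rw [Set.nonempty_iff_ne_empty]
    rintro rfl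
    simp at h3
    omega
  · rintro k' ⟨C, h1, h2, rfl⟩
    exact h.le C (dconvex_iff.1 h1).2 h2

theorem maxClosed_convexityNumber [Fintype V] (A : V → V → Prop)
    (hV : ∃ x y : V, x ≠ y) : MaxClosed A (convexityNumber A) := by
  have hbdd : BddAbove {k | ∃ C : Set V, DConvex A C ∧ C ≠ Set.univ ∧ C.ncard = k} := by
    refine ⟨Fintype.card V, ?_⟩
    rintro k ⟨C, -, -, rfl⟩
    rw [← Nat.card_eq_fintype_card]
    exact Set.ncard_le_card C
  have h1 : (1 : ℕ) ∈ {k | ∃ C : Set V, DConvex A C ∧ C ≠ Set.univ ∧ C.ncard = k} := by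
    obtain ⟨x, y, hxy⟩ := hV
    refine ⟨{x}, dconvex_iff.2 ⟨⟨x, rfl⟩, ?_⟩, ?_, by simp⟩
    · rintro u rfl v rfl p i j h1 h2 hmin
      have := hmin 0 rfl
      have hi : i = 0 := by omega
      subst hi
      exact h1.symm
    · intro h
      have : y ∈ ({x} : Set V) := h ▸ Set.mem_univ y
      exact hxy this.symm
  have hpos : 1 ≤ convexityNumber A := le_csSup hbdd h1
  refine ⟨hpos, ?_, ?_⟩
  · obtain ⟨C, h1, h2, h3⟩ := Nat.sSup_mem ⟨1, h1⟩ hbdd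
    exact ⟨C, (dconvex_iff.1 h1).2, h2, h3⟩
  · intro C hC hne
    rcases C.eq_empty_or_nonempty with rfl | hn
    · simp
    · exact le_csSup hbdd ⟨C, dconvex_iff.2 ⟨hn, hC⟩, hne, rfl⟩


/-! ### Attaching a new row -/

/-- The digraph obtained from `A` by adding a new row (directed from right to left) next to the
row `u`; the columns in `E` get arcs into the new row, the other ones arcs out of the new row. -/
def ExtRel (A : V → V → Prop) (u : Fin 5 → V) (E : Fin 5 → Bool) :
    V ⊕ Fin 5 → V ⊕ Fin 5 → Prop
  | .inl a, .inl b => A a b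
  | .inl a, .inr c => E c = true ∧ a = u c
  | .inr c, .inl b => E c = false ∧ b = u c
  | .inr c, .inr d => d.val + 1 = c.val

/-- The conditions on the row `u` that make `ExtRel` preserve distances. -/
structure RowInv (A : V → V → Prop) (u : Fin 5 → V) (E : Fin 5 → Bool) : Prop where
  row : ∀ c d : Fin 5, c.val + 1 = d.val → A (u c) (u d)
  e4 : E 4 = true
  e0 : E 0 = false
  back : ∀ e f : Fin 5, f < e → E e = true → E f = false →
    WalkRel A (e.val - f.val + 2) (u e) (u f)
  lo : ∀ k, WalkRel A k (u 4) (u 0) → 6 ≤ k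
  lo' : ∀ k, WalkRel A k (u 0) (u 4) → 4 ≤ k

section Ext
variable {A : V → V → Prop} {u : Fin 5 → V} {E : Fin 5 → Bool}

theorem ext_from (h : RowInv A u E) {L : ℕ} {y : V} : ∀ x : V ⊕ Fin 5,
    WalkRel (ExtRel A u E) L x (.inl y) →
    (∀ a, x = .inl a → WalkRel A L a y) ∧
    (∀ c, x = .inr c → ∃ f L', f ≤ c ∧ E f = false ∧ L = (c.val - f.val) + 1 + L' ∧
      WalkRel A L' (u f) y) := by
  induction L with
  | zero =>
    intro x hx
    have hx : x = .inl y := hx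
    subst hx
    exact ⟨fun a ha => (Sum.inl_injective ha).symm, fun c hc => by cases hc⟩
  | succ L ih =>
    rintro x ⟨z, hz, hw⟩
    obtain ⟨ih1, ih2⟩ := ih z hw
    constructor
    · rintro a rfl
      cases z with
      | inl b => exact ⟨b, hz, ih1 b rfl⟩
      | inr c =>
        obtain ⟨hc, rfl⟩ := hz
        obtain ⟨f, L', hf, hE, hL, hw'⟩ := ih2 c rfl
        have hne : f ≠ c := by
          rintro rfl
          simp [hc] at hE
        have hlt : f < c := lt_of_le_of_ne hf hne
        have := walkRel_add (h.back c f hlt hc hE) hw'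
        rw [show L + 1 = c.val - f.val + 2 + L' by omega]
        exact this
    · rintro c rfl
      cases z with
      | inl b =>
        obtain ⟨hc, rfl⟩ := hz
        exact ⟨c, L, le_refl _, hc, by omega, ih1 _ rfl⟩
      | inr d =>
        have hz : d.val + 1 = c.val := hz
        obtain ⟨f, L', hf, hE, hL, hw'⟩ := ih2 d rfl
        have hf' : f.val ≤ d.val := hf
        exact ⟨f, L', by rw [Fin.le_def]; omega, hE, by omega, hw'⟩

theorem ext_inl (h : RowInv A u E) {L : ℕ} {x y : V}
    (hw : WalkRel (ExtRel A u E) L (.inl x) (.inl y)) : WalkRel A L x y :=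
  (ext_from h _ hw).1 x rfl

theorem ext_lift {L : ℕ} {x y : V} (hw : WalkRel A L x y) :
    WalkRel (ExtRel A u E) L (.inl x) (.inl y) := by
  induction L generalizing x with
  | zero => exact congrArg _ hw
  | succ L ih =>
    obtain ⟨z, hz, hw⟩ := hw
    exact ⟨.inl z, hz, ih hw⟩

theorem ext_to (h : RowInv A u E) {L : ℕ} {x : V} : ∀ c : Fin 5,
    WalkRel (ExtRel A u E) L (.inl x) (.inr c) →
    ∃ e L', c ≤ e ∧ E e = true ∧ L = L' + 1 + (e.val - c.val) ∧ WalkRel A L' x (u e) := by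
  induction L with
  | zero =>
    intro c hc
    cases hc
  | succ L ih =>
    intro c hc
    obtain ⟨z, hw, hz⟩ := walkRel_unsnoc hc
    cases z with
    | inl b =>
      obtain ⟨h1, rfl⟩ := hz
      exact ⟨c, L, le_refl _, h1, by omega, ext_inl h hw⟩
    | inr d =>
      have hz : c.val + 1 = d.val := hz
      obtain ⟨e, L', h1, h2, h3, h4⟩ := ih d hw
      have h1' : d.val ≤ e.val := h1
      exact ⟨e, L', by rw [Fin.le_def]; omega, h2, by omega, h4⟩

theorem ext_row {k : ℕ} : ∀ c d : Fin 5, d.val + k = c.val →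
    WalkRel (ExtRel A u E) k (.inr c) (.inr d) := by
  induction k with
  | zero =>
    intro c d h
    exact congrArg _ (Fin.ext (by omega))
  | succ k ih =>
    intro c d h
    have hc := c.isLt
    refine ⟨.inr ⟨c.val - 1, by omega⟩, ?_, ih _ _ ?_⟩
    · change c.val - 1 + 1 = c.val
      omega
    · change d.val + k = c.val - 1
      omega

theorem ext_new_new {L : ℕ} {d : Fin 5} : ∀ c : Fin 5,
    WalkRel (ExtRel A u E) L (.inr c) (.inr d) →
    (d.val ≤ c.val ∧ L = c.val - d.val) ∨
    ∃ f L', f ≤ c ∧ E f = false ∧ L = (c.val - f.val) + 1 + L' ∧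
      WalkRel (ExtRel A u E) L' (.inl (u f)) (.inr d) := by
  induction L with
  | zero =>
    intro c hc
    have : c = d := Sum.inr_injective hc
    subst this
    left; simp
  | succ L ih =>
    rintro c ⟨z, hz, hw⟩
    cases z with
    | inl b =>
      obtain ⟨h1, rfl⟩ := hz
      exact Or.inr ⟨c, L, le_refl _, h1, by omega, hw⟩
    | inr c' =>
      have hz : c'.val + 1 = c.val := hz
      rcases ih c' hw with ⟨h1, h2⟩ | ⟨f, L', h1, h2, h3, h4⟩
      · left; omega
      · have h1' : f.val ≤ c'.val := h1
        exact Or.inr ⟨f, L', by rw [Fin.le_def]; omega, h2, by omega, h4⟩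

theorem row_walk (h : RowInv A u E) {k : ℕ} : ∀ c d : Fin 5, c.val + k = d.val →
    WalkRel A k (u c) (u d) := by
  induction k with
  | zero =>
    intro c d hcd
    exact congrArg _ (Fin.ext (by omega))
  | succ k ih =>
    intro c d hcd
    have hd := d.isLt
    exact ⟨u ⟨c.val + 1, by omega⟩, h.row _ _ rfl, ih _ _ (by simp; omega)⟩

theorem ext_exit {c f : Fin 5} (hf : f ≤ c) (hE : E f = false) :
    WalkRel (ExtRel A u E) (c.val - f.val + 1) (.inr c) (.inl (u f)) := by
  have hf' : f.val ≤ c.val := hf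
  exact walkRel_snoc (ext_row c f (by omega)) ⟨hE, rfl⟩

theorem ext_enter {c e : Fin 5} (he : c ≤ e) (hE : E e = true) :
    WalkRel (ExtRel A u E) (1 + (e.val - c.val)) (.inl (u e)) (.inr c) := by
  have he' : c.val ≤ e.val := he
  refine walkRel_add (walkRel_one (y := Sum.inr e) ⟨hE, rfl⟩) (ext_row e c (by omega))

theorem ext_strong (h : RowInv A u E) (hs : StrongW A) : StrongW (ExtRel A u E) := by
  have h1 : ∀ x : V ⊕ Fin 5, ∃ k b, WalkRel (ExtRel A u E) k x (.inl b) := by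
    rintro (a | c)
    · exact ⟨0, a, rfl⟩
    · exact ⟨_, _, ext_exit (Fin.zero_le c) h.e0⟩
  have h2 : ∀ x : V ⊕ Fin 5, ∃ k b, WalkRel (ExtRel A u E) k (.inl b) x := by
    rintro (a | c)
    · exact ⟨0, a, rfl⟩
    · exact ⟨_, _, ext_enter (Fin.le_last c) h.e4⟩
  intro x y
  obtain ⟨k, a, hk⟩ := h1 x
  obtain ⟨l, b, hl⟩ := h2 y
  obtain ⟨m, hm⟩ := hs a b
  exact ⟨_, walkRel_add (walkRel_add hk (ext_lift hm)) hl⟩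

theorem ext_proj (h : RowInv A u E) {C : Set (V ⊕ Fin 5)} (hC : GeoClosed (ExtRel A u E) C) :
    GeoClosed A (Sum.inl ⁻¹' C) := by
  intro x hx y hy p i j h1 h2 hmin
  exact hC _ hx _ hy _ i j (ext_lift h1) (ext_lift h2) fun k hk => hmin k (ext_inl h hk)

theorem ext_absorb (h : RowInv A u E) {C : Set (V ⊕ Fin 5)} (hC : GeoClosed (ExtRel A u E) C)
    (hu : Sum.inl ⁻¹' C = Set.univ) : C = Set.univ := by
  have hl : ∀ a, Sum.inl a ∈ C := fun a => (hu ▸ Set.mem_univ a : a ∈ Sum.inl ⁻¹' C)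
  rw [Set.eq_univ_iff_forall]
  rintro (a | c)
  · exact hl a
  · refine hC _ (hl (u 4)) _ (hl (u 0)) _ _ _ (ext_enter (Fin.le_last c) h.e4)
      (ext_exit (Fin.zero_le c) h.e0) ?_
    intro k hk
    have := h.lo k (ext_inl h hk)
    have hc := c.isLt
    change 1 + (4 - c.val) + (c.val - 0 + 1) ≤ k
    omega

theorem ext_exists_inl (h : RowInv A u E) (hs : StrongW A) {C : Set (V ⊕ Fin 5)}
    (hC : GeoClosed (ExtRel A u E) C) : ∀ (m : ℕ) (c : Fin 5), c.val = m → Sum.inr c ∈ C →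
    (∃ y ∈ C, y ≠ Sum.inr c) → ∃ b, Sum.inl b ∈ C := by
  intro m
  induction m with
  | zero =>
    rintro c hc hcC ⟨y, hy, hne⟩
    obtain ⟨z, hz, hA⟩ := geoClosed_out (ext_strong h hs) hC hcC hy hne.symm
    cases z with
    | inl b => exact ⟨b, hz⟩
    | inr d =>
      have hA : d.val + 1 = c.val := hA
      omega
  | succ m ih =>
    rintro c hc hcC ⟨y, hy, hne⟩
    obtain ⟨z, hz, hA⟩ := geoClosed_out (ext_strong h hs) hC hcC hy hne.symm
    cases z with
    | inl b => exact ⟨b, hz⟩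
    | inr d =>
      have hA : d.val + 1 = c.val := hA
      refine ih d (by omega) hz ⟨_, hcC, ?_⟩
      intro hh
      have : c = d := Sum.inr_injective hh
      subst this
      omega

theorem ext_pair (h : RowInv A u E) (hs : StrongW A) {C : Set (V ⊕ Fin 5)}
    (hC : GeoClosed (ExtRel A u E) C) {c : Fin 5} (hc : Sum.inr c ∈ C)
    (hy : ∃ y ∈ C, y ≠ Sum.inr c) :
    ∃ e f, E e = true ∧ E f = false ∧ Sum.inl (u e) ∈ C ∧ Sum.inl (u f) ∈ C := by
  obtain ⟨b, hb⟩ := ext_exists_inl h hs hC c.val c rfl hc hy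
  obtain ⟨k, hk, hkm⟩ := exists_min_walk (ext_strong h hs) (.inr c) (.inl b)
  obtain ⟨l, hl, hlm⟩ := exists_min_walk (ext_strong h hs) (.inl b) (.inr c)
  obtain ⟨f, L, hf1, hf2, hf3, hf4⟩ := (ext_from h _ hk).2 c rfl
  obtain ⟨e, M, he1, he2, he3, he4⟩ := ext_to h c hl
  refine ⟨e, f, he2, hf2, ?_, ?_⟩
  · refine hC _ hb _ hc _ M _ (ext_lift he4) (ext_enter he1 he2) ?_
    intro k' hk'
    have := hlm k' hk'
    omega
  · refine hC _ hc _ hb _ _ L (ext_exit hf1 hf2) (ext_lift hf4) ?_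
    intro k' hk'
    have := hkm k' hk'
    omega

/-- Closed sets that contain no entry/exit pair stay closed. -/
theorem ext_closed_b (h : RowInv A u E) {S : Set V} (hS : GeoClosed A S)
    (hef : ∀ e f, E e = true → E f = false → u e ∈ S → u f ∈ S → False) :
    GeoClosed (ExtRel A u E) (Sum.inl '' S) := by
  rintro _ ⟨x, hx, rfl⟩ _ ⟨y, hy, rfl⟩ p i j h1 h2 hmin
  cases p with
  | inl p =>
    exact ⟨p, hS x hx y hy p i j (ext_inl h h1) (ext_inl h h2)
      (fun k hk => hmin k (ext_lift hk)), rfl⟩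
  | inr c =>
    exfalso
    obtain ⟨e, M, he1, he2, he3, he4⟩ := ext_to h c h1
    obtain ⟨f, L, hf1, hf2, hf3, hf4⟩ := (ext_from h _ h2).2 c rfl
    have he1' : c.val ≤ e.val := he1
    have hf1' : f.val ≤ c.val := hf1
    have hne : f ≠ e := by
      rintro rfl
      simp [he2] at hf2
    have hlt : f < e := lt_of_le_of_ne (hf1.trans he1) hne
    have hw := h.back e f hlt he2 hf2
    refine hef e f he2 hf2 ?_ ?_
    · refine hS x hx y hy _ M _ he4 (walkRel_add hw hf4) ?_
      intro k hk
      have := hmin k (ext_lift hk)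
      omega
    · refine hS x hx y hy _ _ L (walkRel_add he4 hw) hf4 ?_
      intro k hk
      have := hmin k (ext_lift hk)
      omega

/-- Closed sets that contain the row `u` stay closed after adding the new row. -/
theorem ext_closed_a (h : RowInv A u E) {S : Set V} (hS : GeoClosed A S)
    (hu : ∀ c, u c ∈ S) :
    GeoClosed (ExtRel A u E) (Sum.inl '' S ∪ Set.range Sum.inr) := by
  intro x hx y hy p i j h1 h2 hmin
  cases p with
  | inr c => exact Or.inr ⟨c, rfl⟩
  | inl p =>
    left
    refine ⟨p, ?_, rfl⟩
    obtain ⟨x', hx', i0, i1, hxx, hi, hw1⟩ : ∃ x' ∈ S, ∃ i0 i1,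
        WalkRel (ExtRel A u E) i0 x (.inl x') ∧ i = i0 + i1 ∧ WalkRel A i1 x' p := by
      rcases hx with ⟨x, hx, rfl⟩ | ⟨c, rfl⟩
      · exact ⟨x, hx, 0, i, rfl, by omega, ext_inl h h1⟩
      · obtain ⟨f, L, hf1, hf2, hf3, hf4⟩ := (ext_from h _ h1).2 c rfl
        exact ⟨u f, hu f, _, L, ext_exit hf1 hf2, hf3, hf4⟩
    obtain ⟨y', hy', j0, j1, hyy, hj, hw2⟩ : ∃ y' ∈ S, ∃ j0 j1,
        WalkRel (ExtRel A u E) j0 (.inl y') y ∧ j = j1 + j0 ∧ WalkRel A j1 p y' := by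
      rcases hy with ⟨y, hy, rfl⟩ | ⟨c, rfl⟩
      · exact ⟨y, hy, 0, j, rfl, by omega, ext_inl h h2⟩
      · obtain ⟨e, M, he1, he2, he3, he4⟩ := ext_to h c h2
        exact ⟨u e, hu e, _, M, ext_enter he1 he2, by omega, he4⟩
    refine hS x' hx' y' hy' p i1 j1 hw1 hw2 ?_
    intro k hk
    have := hmin _ (walkRel_add (walkRel_add hxx (ext_lift hk)) hyy)
    omega

/-- The new row satisfies the row condition again, after reversing all arcs. -/
theorem ext_rowInv (h : RowInv A u E) : RowInv (flip (ExtRel A u E)) Sum.inr E := by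
  refine ⟨fun c d hcd => hcd, h.e4, h.e0, ?_, ?_, ?_⟩
  · intro e f hlt he hf
    rw [walkRel_flip]
    have hlt' : f.val < e.val := hlt
    have h1 : WalkRel (ExtRel A u E) 1 (.inr f) (.inl (u f)) := walkRel_one ⟨hf, rfl⟩
    have h2 : WalkRel (ExtRel A u E) 1 (.inl (u e)) (.inr e) := walkRel_one ⟨he, rfl⟩
    have h3 : WalkRel A (e.val - f.val) (u f) (u e) := row_walk h f e (by omega)
    have := walkRel_add (walkRel_add h1 (ext_lift h3)) h2
    rwa [show 1 + (e.val - f.val) + 1 = e.val - f.val + 2 by omega] at this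
  · intro k hk
    rw [walkRel_flip] at hk
    rcases ext_new_new _ hk with ⟨h1, _⟩ | ⟨f, L', h1, h2, h3, h4⟩
    · exact absurd h1 (by decide)
    · have hf : f = 0 := le_antisymm h1 (Fin.zero_le f)
      subst hf
      obtain ⟨e, M, he1, he2, he3, he4⟩ := ext_to h _ h4
      have he : e = 4 := le_antisymm (Fin.le_last e) he1
      subst he
      have := h.lo' M he4
      omega
  · intro k hk
    rw [walkRel_flip] at hk
    rcases ext_new_new _ hk with ⟨h1, h2⟩ | ⟨f, L', h1, h2, h3, h4⟩
    · have : k = 4 := h2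
      omega
    · obtain ⟨e, M, he1, he2, he3, he4⟩ := ext_to h _ h4
      have hf : f.val ≠ 4 := by
        intro hf
        have : f = 4 := Fin.ext hf
        subst this
        rw [h.e4] at h2
        cases h2
      have he : e.val ≠ 0 := by
        intro he
        have : e = 0 := Fin.ext he
        subst this
        rw [h.e0] at he2
        cases he2
      have h4' : ((4 : Fin 5) : ℕ) = 4 := rfl
      have h0' : ((0 : Fin 5) : ℕ) = 0 := rfl
      have := f.isLt
      omega

end Ext


/-! ### Grids -/

theorem grid_adj {n m : ℕ} {x y : Fin n × Fin m} : (gridGraph n m).Adj x y ↔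
    ((x.1.val + 1 = y.1.val ∨ y.1.val + 1 = x.1.val) ∧ x.2.val = y.2.val) ∨
    ((x.2.val + 1 = y.2.val ∨ y.2.val + 1 = x.2.val) ∧ x.1.val = y.1.val) := by
  unfold gridGraph
  rw [SimpleGraph.boxProd_adj, SimpleGraph.pathGraph_adj, SimpleGraph.pathGraph_adj, Fin.ext_iff,
    Fin.ext_iff]

theorem isOrientation_flip {G : SimpleGraph V} {A : V → V → Prop} (h : IsOrientation G A) :
    IsOrientation G (flip A) :=
  ⟨fun x y hxy => (h.1 y x hxy).symm, fun x y hxy => h.2.1 y x hxy.symm,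
    fun x y hxy hyx => h.2.2 y x hxy hyx⟩

/-- Last row of a grid. -/
def botRow {W : Type} {n : ℕ} (φ : W ≃ Fin (n + 1) × Fin 5) (c : Fin 5) : W :=
  φ.symm (Fin.last n, c)

/-- First row of a grid. -/
def topRow {W : Type} {n : ℕ} (φ : W ≃ Fin (n + 1) × Fin 5) (c : Fin 5) : W :=
  φ.symm (0, c)

/-- A strong orientation of the grid (with vertices labelled by `W`). -/
structure GridCore {W : Type} {n : ℕ} (φ : W ≃ Fin (n + 1) × Fin 5) (A : W → W → Prop) : Prop where
  ori : IsOrientation ((gridGraph (n + 1) 5).comap φ) A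
  strong : StrongW A

theorem GridCore.flip {W : Type} {n : ℕ} {φ : W ≃ Fin (n + 1) × Fin 5} {A : W → W → Prop}
    (h : GridCore φ A) : GridCore φ (flip A) :=
  ⟨isOrientation_flip h.ori, strongW_flip h.strong⟩

theorem MaxClosed.flip {A : V → V → Prop} {k : ℕ} (h : MaxClosed A k) : MaxClosed (flip A) k := by
  refine ⟨h.pos, ?_, fun C hC => h.le C (geoClosed_flip_iff.1 hC)⟩
  obtain ⟨S, h1, h2⟩ := h.ex
  exact ⟨S, geoClosed_flip h1, h2⟩

/-- Underlying function of `extEquiv`. -/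
def extFun {W : Type} {n : ℕ} (φ : W ≃ Fin (n + 1) × Fin 5) : W ⊕ Fin 5 → Fin (n + 2) × Fin 5
  | .inl a => ((φ a).1.castSucc, (φ a).2)
  | .inr c => (Fin.last (n + 1), c)

theorem extFun_bij {W : Type} {n : ℕ} (φ : W ≃ Fin (n + 1) × Fin 5) :
    Function.Bijective (extFun φ) := by
  constructor
  · rintro (a | c) (b | d) h
    · have h1 := congrArg Prod.fst h
      have h2 := congrArg Prod.snd h
      have : φ a = φ b := Prod.ext (Fin.castSucc_injective _ h1) h2
      rw [φ.injective this]
    · exfalso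
      have h1 := congrArg (fun z => z.1.val) h
      have := (φ a).1.isLt
      simp [extFun] at h1
      omega
    · exfalso
      have h1 := congrArg (fun z => z.1.val) h
      have := (φ b).1.isLt
      simp [extFun] at h1
      omega
    · have h2 := congrArg Prod.snd h
      exact congrArg _ h2
  · rintro ⟨r, c⟩
    by_cases hr : r.val = n + 1
    · exact ⟨.inr c, Prod.ext (Fin.ext hr.symm) rfl⟩
    · have := r.isLt
      refine ⟨.inl (φ.symm (⟨r.val, by omega⟩, c)), ?_⟩
      simp [extFun]

/-- Labelling of the extended grid. -/
noncomputable def extEquiv {W : Type} {n : ℕ} (φ : W ≃ Fin (n + 1) × Fin 5) :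
    W ⊕ Fin 5 ≃ Fin (n + 2) × Fin 5 :=
  Equiv.ofBijective (extFun φ) (extFun_bij φ)

theorem extEquiv_bot {W : Type} {n : ℕ} (φ : W ≃ Fin (n + 1) × Fin 5) :
    botRow (extEquiv φ) = Sum.inr := by
  funext c
  rw [botRow, Equiv.symm_apply_eq]
  rfl

theorem extEquiv_top {W : Type} {n : ℕ} (φ : W ≃ Fin (n + 1) × Fin 5) (c : Fin 5) :
    topRow (extEquiv φ) c = Sum.inl (topRow φ c) := by
  rw [topRow, Equiv.symm_apply_eq]
  change _ = ((φ (φ.symm (0, c))).1.castSucc, (φ (φ.symm (0, c))).2)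
  simp

theorem extCore {W : Type} {n : ℕ} {φ : W ≃ Fin (n + 1) × Fin 5} {A : W → W → Prop}
    (h : GridCore φ A) {E : Fin 5 → Bool} (hr : RowInv A (botRow φ) E) :
    GridCore (extEquiv φ) (ExtRel A (botRow φ) E) := by
  refine ⟨⟨?_, ?_, ?_⟩, ext_strong hr h.strong⟩
  · rintro (a | c) (b | d) hA
    · have := h.ori.1 a b hA
      rw [SimpleGraph.comap_adj, grid_adj] at this ⊢
      exact this
    · obtain ⟨h1, rfl⟩ := hA
      rw [SimpleGraph.comap_adj, grid_adj]
      change ((φ (φ.symm _)).1.val + 1 = n + 1 ∨ _) ∧ (φ (φ.symm _)).2.val = d.val ∨ _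
      simp
    · obtain ⟨h1, rfl⟩ := hA
      rw [SimpleGraph.comap_adj, grid_adj]
      change ((n + 1) + 1 = (φ (φ.symm _)).1.val ∨ (φ (φ.symm _)).1.val + 1 = n + 1) ∧
        c.val = (φ (φ.symm _)).2.val ∨ _
      simp
    · have hA : d.val + 1 = c.val := hA
      rw [SimpleGraph.comap_adj, grid_adj]
      exact Or.inr ⟨Or.inr hA, rfl⟩
  · rintro (a | c) (b | d) hG
    · rw [SimpleGraph.comap_adj, grid_adj] at hG
      refine h.ori.2.1 a b ?_
      rw [SimpleGraph.comap_adj, grid_adj]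
      exact hG
    · rw [SimpleGraph.comap_adj, grid_adj] at hG
      change (((φ a).1.val + 1 = n + 1 ∨ n + 1 + 1 = (φ a).1.val) ∧ (φ a).2.val = d.val) ∨
        (_ ∧ (φ a).1.val = n + 1) at hG
      have hlt := (φ a).1.isLt
      have ha : a = botRow φ d := by
        rw [botRow, Equiv.eq_symm_apply]
        refine Prod.ext (Fin.ext ?_) (Fin.ext ?_)
        · change (φ a).1.val = n
          omega
        · change (φ a).2.val = d.val
          omega
      cases hE : E d with
      | true => exact Or.inl ⟨hE, ha⟩
      | false => exact Or.inr ⟨hE, ha⟩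
    · rw [SimpleGraph.comap_adj, grid_adj] at hG
      change ((n + 1 + 1 = (φ b).1.val ∨ (φ b).1.val + 1 = n + 1) ∧ c.val = (φ b).2.val) ∨
        (_ ∧ n + 1 = (φ b).1.val) at hG
      have hlt := (φ b).1.isLt
      have ha : b = botRow φ c := by
        rw [botRow, Equiv.eq_symm_apply]
        refine Prod.ext (Fin.ext ?_) (Fin.ext ?_)
        · change (φ b).1.val = n
          omega
        · change (φ b).2.val = c.val
          omega
      cases hE : E c with
      | true => exact Or.inr ⟨hE, ha⟩
      | false => exact Or.inl ⟨hE, ha⟩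
    · rw [SimpleGraph.comap_adj, grid_adj] at hG
      change ((n + 1 + 1 = n + 1 ∨ n + 1 + 1 = n + 1) ∧ _) ∨
        ((c.val + 1 = d.val ∨ d.val + 1 = c.val) ∧ _) at hG
      change d.val + 1 = c.val ∨ c.val + 1 = d.val
      omega
  · rintro (a | c) (b | d) h1 h2
    · exact h.ori.2.2 a b h1 h2
    · have e1 := h1.1
      have e2 := h2.1
      rw [e1] at e2
      cases e2
    · have e1 := h1.1
      have e2 := h2.1
      rw [e1] at e2
      cases e2
    · have h1 : d.val + 1 = c.val := h1
      have h2 : c.val + 1 = d.val := h2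
      omega

theorem rowInv_lift {A : V → V → Prop} {u v : Fin 5 → V} {E F : Fin 5 → Bool}
    (h : RowInv A u E) (h' : RowInv A v F) :
    RowInv (ExtRel A u E) (fun c => Sum.inl (v c)) F :=
  ⟨h'.row, h'.e4, h'.e0, fun e f a b c => ext_lift (h'.back e f a b c),
    fun k hk => h'.lo k (ext_inl h hk), fun k hk => h'.lo' k (ext_inl h hk)⟩

theorem rowInv_lift_flip {A : V → V → Prop} {u v : Fin 5 → V} {E F : Fin 5 → Bool}
    (h : RowInv A u E) (h' : RowInv (flip A) v F) :
    RowInv (flip (ExtRel A u E)) (fun c => Sum.inl (v c)) F :=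
  ⟨h'.row, h'.e4, h'.e0,
    fun e f a b c => walkRel_flip.2 (ext_lift (walkRel_flip.1 (h'.back e f a b c))),
    fun k hk => h'.lo k (walkRel_flip.2 (ext_inl h (walkRel_flip.1 hk))),
    fun k hk => h'.lo' k (walkRel_flip.2 (ext_inl h (walkRel_flip.1 hk)))⟩

/-- The top row lies in a largest closed set and satisfies the row condition. -/
def TopGood {W : Type} {n : ℕ} (φ : W ≃ Fin (n + 1) × Fin 5) (A : W → W → Prop) (k : ℕ) : Prop :=
  (∃ S : Set W, GeoClosed A S ∧ S ≠ Set.univ ∧ S.ncard = k ∧ ∀ c, topRow φ c ∈ S) ∧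
    ∃ E, RowInv A (topRow φ) E ∨ RowInv (flip A) (topRow φ) E

/-- Orientations with `n + 1` rows that can be extended at the bottom keeping `k`. -/
def BGood (t : Bool) (n k : ℕ) : Prop :=
  ∃ (W : Type) (_ : Finite W) (φ : W ≃ Fin (n + 1) × Fin 5) (A : W → W → Prop) (E : Fin 5 → Bool),
    GridCore φ A ∧ RowInv A (botRow φ) E ∧ MaxClosed A k ∧
    (∀ C, GeoClosed A C → ∀ e f, E e = true → E f = false → botRow φ e ∈ C → botRow φ f ∈ C →
      C = Set.univ) ∧ (t = true → TopGood φ A k)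

/-- Orientations with `n + 1` rows that can be extended at the bottom, increasing `k` by 5. -/
def AGood (n k : ℕ) : Prop :=
  ∃ (W : Type) (_ : Finite W) (φ : W ≃ Fin (n + 1) × Fin 5) (A : W → W → Prop) (E : Fin 5 → Bool),
    GridCore φ A ∧ RowInv A (botRow φ) E ∧ MaxClosed A k ∧
    (∃ S : Set W, GeoClosed A S ∧ S ≠ Set.univ ∧ S.ncard = k ∧ ∀ c, botRow φ c ∈ S)

/-- Orientations with `n + 1` rows and convexity number `k`. -/
def CGood (n k : ℕ) : Prop :=
  ∃ (W : Type) (_ : Finite W) (φ : W ≃ Fin (n + 1) × Fin 5) (A : W → W → Prop),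
    GridCore φ A ∧ MaxClosed A k

theorem BGood.step {t : Bool} {n k : ℕ} (h : BGood t n k) : BGood t (n + 1) k := by
  obtain ⟨W, hW, φ, A, E, hc, hr, hm, hh, ht⟩ := h
  have hnot : ∀ S : Set W, GeoClosed A S → S ≠ Set.univ →
      ∀ e f, E e = true → E f = false → botRow φ e ∈ S → botRow φ f ∈ S → False :=
    fun S hS hne e f he hf h1 h2 => hne (hh S hS e f he hf h1 h2)
  have hfull : ∀ C, GeoClosed (ExtRel A (botRow φ) E) C → ∀ c : Fin 5, Sum.inr c ∈ C →
      (∃ y ∈ C, y ≠ Sum.inr c) → C = Set.univ := by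
    intro C hC c hcC hy
    obtain ⟨e, f, he, hf, h1, h2⟩ := ext_pair hr hc.strong hC hcC hy
    exact ext_absorb hr hC (hh _ (ext_proj hr hC) e f he hf h1 h2)
  have hne' : ∀ S : Set W, (Sum.inl '' S : Set (W ⊕ Fin 5)) ≠ Set.univ := by
    intro S hS
    have : (Sum.inr 0 : W ⊕ Fin 5) ∈ (Sum.inl '' S : Set (W ⊕ Fin 5)) := hS ▸ Set.mem_univ _
    obtain ⟨a, _, ha⟩ := this
    cases ha
  have hcard : ∀ S : Set W, (Sum.inl '' S : Set (W ⊕ Fin 5)).ncard = S.ncard :=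
    fun S => Set.ncard_image_of_injective S Sum.inl_injective
  refine ⟨W ⊕ Fin 5, inferInstance, extEquiv φ, flip (ExtRel A (botRow φ) E), E,
    (extCore hc hr).flip, ?_, MaxClosed.flip ?_, ?_, ?_⟩
  · rw [extEquiv_bot]
    exact ext_rowInv hr
  · refine ⟨hm.pos, ?_, ?_⟩
    · obtain ⟨S, h1, h2, h3⟩ := hm.ex
      exact ⟨Sum.inl '' S, ext_closed_b hr h1 (hnot S h1 h2), hne' S, (hcard S).trans h3⟩
    · intro C hC hne
      by_cases hex : ∃ c : Fin 5, Sum.inr c ∈ C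
      · obtain ⟨c, hcC⟩ := hex
        by_cases hy : ∃ y ∈ C, y ≠ Sum.inr c
        · exact absurd (hfull C hC c hcC hy) hne
        · push Not at hy
          have : C ⊆ {Sum.inr c} := fun y hyC => hy y hyC
          have h1 := Set.ncard_le_ncard this
          rw [Set.ncard_singleton] at h1
          exact h1.trans hm.pos
      · push Not at hex
        have hCe : C = Sum.inl '' (Sum.inl ⁻¹' C) := by
          ext x
          constructor
          · intro hx
            cases x with
            | inl a => exact ⟨a, hx, rfl⟩
            | inr c => exact absurd hx (hex c)
          · rintro ⟨a, ha, rfl⟩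
            exact ha
        rw [hCe, hcard]
        refine hm.le _ (ext_proj hr hC) ?_
        intro hu
        exact hne (ext_absorb hr hC hu)
  · intro C hC e f he hf h1 h2
    rw [extEquiv_bot] at h1 h2
    refine hfull C (geoClosed_flip_iff.1 hC) e h1 ⟨_, h2, ?_⟩
    intro hef
    have : f = e := Sum.inr_injective hef
    subst this
    rw [he] at hf
    cases hf
  · intro htt
    obtain ⟨⟨S, h1, h2, h3, h4⟩, F, hF⟩ := ht htt
    refine ⟨⟨Sum.inl '' S, geoClosed_flip (ext_closed_b hr h1 (hnot S h1 h2)), hne' S,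
      (hcard S).trans h3, ?_⟩, F, ?_⟩
    · intro c
      rw [extEquiv_top]
      exact ⟨_, h4 c, rfl⟩
    · have htop : topRow (extEquiv φ) = fun c => Sum.inl (topRow φ c) := by
        funext c
        exact extEquiv_top φ c
      rw [htop]
      rcases hF with hF | hF
      · exact Or.inr (rowInv_lift hr hF)
      · exact Or.inl (rowInv_lift_flip hr hF)

theorem AGood.step {n k : ℕ} (h : AGood n k) : AGood (n + 1) (k + 5) := by
  obtain ⟨W, hW, φ, A, E, hc, hr, hm, S, hS, hSne, hSk, hSb⟩ := h
  have hcl := ext_closed_a hr hS hSb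
  have hcard : ∀ S : Set W,
      (Sum.inl '' S ∪ Set.range Sum.inr : Set (W ⊕ Fin 5)).ncard = S.ncard + 5 := by
    intro S
    rw [Set.ncard_union_eq, Set.ncard_image_of_injective S Sum.inl_injective]
    · rw [← Set.image_univ, Set.ncard_image_of_injective _ Sum.inr_injective]
      simp
    · rw [Set.disjoint_left]
      rintro _ ⟨a, _, rfl⟩ ⟨c, hc⟩
      cases hc
  have hne : (Sum.inl '' S ∪ Set.range Sum.inr : Set (W ⊕ Fin 5)) ≠ Set.univ := by
    intro hu
    apply hSne
    rw [Set.eq_univ_iff_forall] at hu ⊢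
    intro a
    rcases hu (Sum.inl a) with ⟨b, hb, hba⟩ | ⟨c, hc⟩
    · cases hba
      exact hb
    · cases hc
  refine ⟨W ⊕ Fin 5, inferInstance, extEquiv φ, flip (ExtRel A (botRow φ) E), E,
    (extCore hc hr).flip, ?_, MaxClosed.flip ?_, _, geoClosed_flip hcl, hne, ?_, ?_⟩
  · rw [extEquiv_bot]
    exact ext_rowInv hr
  · refine ⟨by omega, ⟨_, hcl, hne, ?_⟩, ?_⟩
    · rw [hcard, hSk]
    · intro C hC hCne
      have h1 : C ⊆ Sum.inl '' (Sum.inl ⁻¹' C) ∪ Set.range Sum.inr := by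
        intro x hx
        cases x with
        | inl a => exact Or.inl ⟨a, hx, rfl⟩
        | inr c => exact Or.inr ⟨c, rfl⟩
      have h2 := Set.ncard_le_ncard h1
      rw [hcard] at h2
      have h3 := hm.le _ (ext_proj hr hC) fun hu => hCne (ext_absorb hr hC hu)
      omega
  · rw [hcard, hSk]
  · intro c
    rw [extEquiv_bot]
    exact Or.inr ⟨c, rfl⟩

theorem AGood.toC {n k : ℕ} (h : AGood n k) : CGood n k := by
  obtain ⟨W, hW, φ, A, E, hc, hr, hm, _⟩ := h
  exact ⟨W, hW, φ, A, hc, hm⟩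

theorem BGood.toC {t : Bool} {n k : ℕ} (h : BGood t n k) : CGood n k := by
  obtain ⟨W, hW, φ, A, E, hc, hr, hm, _⟩ := h
  exact ⟨W, hW, φ, A, hc, hm⟩

/-- Reflection of the rows. -/
def rowRev (n : ℕ) : Fin (n + 1) × Fin 5 ≃ Fin (n + 1) × Fin 5 :=
  Equiv.prodCongr Fin.revPerm (Equiv.refl _)

/-- Turning a grid upside down. -/
theorem topGood_to_A {W : Type} (hW : Finite W) {n k : ℕ} {φ : W ≃ Fin (n + 1) × Fin 5}
    {A : W → W → Prop} (hc : GridCore φ A) (hm : MaxClosed A k) (ht : TopGood φ A k) :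
    AGood n k := by
  obtain ⟨⟨S, h1, h2, h3, h4⟩, F, hF⟩ := ht
  have hrow : botRow (φ.trans (rowRev n)) = topRow φ := by
    funext c
    rw [botRow, topRow, Equiv.symm_apply_eq]
    simp [rowRev]
  have hG : (gridGraph (n + 1) 5).comap (φ.trans (rowRev n)) = (gridGraph (n + 1) 5).comap φ := by
    ext x y
    rw [SimpleGraph.comap_adj, SimpleGraph.comap_adj, grid_adj, grid_adj]
    simp only [rowRev, Equiv.trans_apply, Equiv.prodCongr_apply, Prod.map, Fin.revPerm_apply,
      Fin.val_rev, Equiv.refl_apply]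
    have := (φ x).1.isLt
    have := (φ y).1.isLt
    omega
  have hc' : GridCore (φ.trans (rowRev n)) A := ⟨by rw [hG]; exact hc.ori, hc.strong⟩
  rcases hF with hF | hF
  · refine ⟨W, hW, φ.trans (rowRev n), A, F, hc', ?_, hm, S, h1, h2, h3, ?_⟩
    · rw [hrow]
      exact hF
    · rw [hrow]
      exact h4
  · refine ⟨W, hW, φ.trans (rowRev n), flip A, F, hc'.flip, ?_, hm.flip, S, geoClosed_flip h1,
      h2, h3, ?_⟩
    · rw [hrow]
      exact hF
    · rw [hrow]
      exact h4

theorem BGood.toA {n k : ℕ} (h : BGood true n k) : AGood n k := by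
  obtain ⟨W, hW, φ, A, E, hc, hr, hm, _, ht⟩ := h
  exact topGood_to_A hW hc hm (ht rfl)

theorem BGood.steps {t : Bool} {n k : ℕ} (h : BGood t n k) (i : ℕ) : BGood t (n + i) k := by
  induction i with
  | zero => exact h
  | succ i ih => exact ih.step

theorem AGood.steps {n k : ℕ} (h : AGood n k) (i : ℕ) : AGood (n + i) (k + 5 * i) := by
  induction i with
  | zero => exact h
  | succ i ih => exact ih.step

theorem walkRel_equiv {W V' : Type} (φ : W ≃ V') (A : W → W → Prop) {k : ℕ} {x y : V'} :
    WalkRel (fun a b => A (φ.symm a) (φ.symm b)) k x y ↔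
      WalkRel A k (φ.symm x) (φ.symm y) := by
  induction k generalizing x with
  | zero => exact φ.symm.injective.eq_iff.symm
  | succ k ih =>
    constructor
    · rintro ⟨z, hz, h⟩
      exact ⟨φ.symm z, hz, ih.1 h⟩
    · rintro ⟨z, hz, h⟩
      exact ⟨φ z, by simpa using hz, ih.2 (by simpa using h)⟩

theorem geoClosed_equiv {W V' : Type} (φ : W ≃ V') (A : W → W → Prop) {C : Set V'} :
    GeoClosed (fun a b => A (φ.symm a) (φ.symm b)) C ↔ GeoClosed A (φ ⁻¹' C) := by
  constructor
  · intro h x hx y hy p i j h1 h2 hmin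
    refine h _ hx _ hy (φ p) i j ?_ ?_ ?_
    · rw [walkRel_equiv]; simpa using h1
    · rw [walkRel_equiv]; simpa using h2
    · intro k hk
      rw [walkRel_equiv] at hk
      exact hmin k (by simpa using hk)
  · intro h x hx y hy p i j h1 h2 hmin
    rw [walkRel_equiv] at h1 h2
    have := h (φ.symm x) (by simpa using hx) (φ.symm y) (by simpa using hy) (φ.symm p) i j h1 h2
      (fun k hk => hmin k (walkRel_equiv φ A |>.2 hk))
    simpa using this

theorem CGood.mem {n k : ℕ} (h : CGood n k) :
    k ∈ strongConvexitySpectrum (gridGraph (n + 1) 5) := by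
  obtain ⟨W, hW, φ, A, hc, hm⟩ := h
  have hcard : ∀ C : Set (Fin (n + 1) × Fin 5), (φ ⁻¹' C).ncard = C.ncard := by
    intro C
    rw [← Equiv.image_symm_eq_preimage]
    exact Set.ncard_image_of_injective C φ.symm.injective
  refine ⟨fun a b => A (φ.symm a) (φ.symm b), ⟨?_, ?_, ?_⟩, ?_, convexityNumber_eq ⟨hm.pos, ?_, ?_⟩⟩
  · intro x y hxy
    have := hc.ori.1 _ _ hxy
    simpa using this
  · intro x y hxy
    exact hc.ori.2.1 _ _ (by simpa using hxy)
  · intro x y hxy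
    exact hc.ori.2.2 _ _ hxy
  · rw [strongConnected_iff]
    intro x y
    obtain ⟨k, hk⟩ := hc.strong (φ.symm x) (φ.symm y)
    exact ⟨k, (walkRel_equiv φ A).2 hk⟩
  · obtain ⟨S, h1, h2, h3⟩ := hm.ex
    have hS : φ ⁻¹' (φ.symm ⁻¹' S) = S := by
      ext x; simp
    refine ⟨φ.symm ⁻¹' S, ?_, ?_, ?_⟩
    · rw [geoClosed_equiv, hS]
      exact h1
    · intro hu
      apply h2
      rw [← hS, hu]
      rfl
    · rw [← hcard, hS, h3]
  · intro C hC hne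
    rw [← hcard]
    refine hm.le _ ((geoClosed_equiv φ A).1 hC) ?_
    intro hu
    apply hne
    rw [Set.eq_univ_iff_forall] at hu ⊢
    intro x
    have := hu (φ.symm x)
    simpa using this


/-! ### Checking explicit small orientations -/

/-- Arc of an explicit grid orientation; vertices are coded as `5 * row + column`. -/
def cArc (H U a b : ℕ) : Bool :=
  (b == a + 1 && a % 5 != 4 && !H.testBit a) || (a == b + 1 && b % 5 != 4 && H.testBit b) ||
    (b == a + 5 && !U.testBit a) || (a == b + 5 && U.testBit b)

/-- An explicit grid orientation with `n + 1` rows, its distance table, a closed set and a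
certificate that this set contains all proper closed sets with at least two elements. -/
structure Base where
  n : ℕ
  H : ℕ
  U : ℕ
  D : ℕ
  S : ℕ
  cert : List (ℕ × ℕ × List (ℕ × ℕ))

namespace Base

def M (B : Base) : ℕ := (B.n + 1) * 5

def d (B : Base) (x y : ℕ) : ℕ := (B.D >>> (5 * (B.M * x + y))) % 32

def outs (B : Base) (x : ℕ) : List ℕ :=
  [x + 1, x + 5, x - 1, x - 5].filter fun y => cArc B.H B.U x y && decide (y < B.M)

def chkD (B : Base) : Bool :=
  (List.range B.M).all fun x => (List.range B.M).all fun v =>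
    (if x = v then B.d x v == 0 else (B.outs x).any fun y => B.d x v == B.d y v + 1) &&
      (B.outs x).all fun y => decide (B.d x v ≤ B.d y v + 1)

def chkS (B : Base) : Bool :=
  (List.range B.M).all fun u => !B.S.testBit u || (List.range B.M).all fun v => !B.S.testBit v ||
    (List.range B.M).all fun x => B.S.testBit x || B.d u x + B.d x v != B.d u v

/-- Add all vertices on geodesics from `p` to `q`. -/
def addI (B : Base) (p q : ℕ) (L : List ℕ) : List ℕ :=
  ((List.range B.M).filter fun x => B.d p x + B.d x q == B.d p q) ++ L

def runSteps (B : Base) : List (ℕ × ℕ) → List ℕ → List ℕ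
  | [], L => L
  | (p, q) :: l, L => B.runSteps l (if L.elem p && L.elem q then B.addI p q L else L)

def runCert (B : Base) : List (ℕ × ℕ × List (ℕ × ℕ)) → List (ℕ × ℕ) → Option (List (ℕ × ℕ))
  | [], K => some K
  | (a, b, st) :: l, K =>
    let L := B.runSteps st [a, b]
    if (K.any fun p => L.elem p.1 && L.elem p.2) || (List.range B.M).all fun x => L.elem x then
      B.runCert l ((a, b) :: K)
    else none

def chkC (B : Base) : Bool :=
  match B.runCert B.cert [] with
  | none => false
  | some K => (List.range B.M).all fun x => (B.outs x).all fun y =>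
      (B.S.testBit x && B.S.testBit y) || K.any fun p => p.1 == x && p.2 == y

def chkN (B : Base) (k : ℕ) : Bool :=
  decide (1 ≤ k) && ((List.range B.M).countP fun x => B.S.testBit x) == k &&
    (List.range B.M).any fun x => !B.S.testBit x

def chk (B : Base) (k : ℕ) : Bool := B.chkD && B.chkS && B.chkC && B.chkN k

/-- Distance, possibly reversed. -/
def dr (B : Base) (rev : Bool) (x y : ℕ) : ℕ := if rev then B.d y x else B.d x y

def chkRow (B : Base) (rev : Bool) (b E : ℕ) : Bool :=
  ((List.range 4).all fun c => if rev then cArc B.H B.U (b + c + 1) (b + c)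
      else cArc B.H B.U (b + c) (b + c + 1)) &&
    E.testBit 4 && !E.testBit 0 && decide (6 ≤ B.dr rev (b + 4) b) &&
    decide (4 ≤ B.dr rev b (b + 4)) &&
    (List.range 5).all fun e => (List.range e).all fun f => !E.testBit e || E.testBit f ||
      B.dr rev (b + e) (b + f) == e - f + 2

def chkBot (B : Base) (E : ℕ) : Bool :=
  (List.range 5).all fun e => (List.range 5).all fun f => !E.testBit e || E.testBit f ||
    !(B.S.testBit (B.n * 5 + e) && B.S.testBit (B.n * 5 + f))

def chkTop (B : Base) : Bool := (List.range 5).all fun c => B.S.testBit c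

/-- The orientation. -/
def A (B : Base) (x y : Fin ((B.n + 1) * 5)) : Prop := cArc B.H B.U x.val y.val = true

theorem mem_outs (B : Base) {x y : ℕ} : y ∈ B.outs x ↔ cArc B.H B.U x y = true ∧ y < B.M := by
  unfold outs
  rw [List.mem_filter]
  simp only [Bool.and_eq_true, decide_eq_true_eq]
  constructor
  · exact fun h => h.2
  · refine fun h => ⟨?_, h⟩
    have h1 := h.1
    simp only [cArc, Bool.or_eq_true, Bool.and_eq_true, beq_iff_eq] at h1
    simp only [List.mem_cons, List.not_mem_nil, or_false]
    omega

def phi (B : Base) : Fin ((B.n + 1) * 5) ≃ Fin (B.n + 1) × Fin 5 := finProdFinEquiv.symm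

theorem ori (B : Base) : IsOrientation ((gridGraph (B.n + 1) 5).comap B.phi) B.A := by
  have h1 : ∀ x, (B.phi x).1.val = x.val / 5 := fun x => rfl
  have h2 : ∀ x, (B.phi x).2.val = x.val % 5 := fun x => rfl
  refine ⟨?_, ?_, ?_⟩
  · intro x y h
    rw [SimpleGraph.comap_adj, grid_adj, h1, h1, h2, h2]
    simp only [A, cArc, Bool.or_eq_true, Bool.and_eq_true, beq_iff_eq, bne_iff_ne] at h
    omega
  · intro x y h
    rw [SimpleGraph.comap_adj, grid_adj, h1, h1, h2, h2] at h
    have h' : (y.val = x.val + 5) ∨ (x.val = y.val + 5) ∨ (y.val = x.val + 1 ∧ x.val % 5 ≠ 4) ∨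
        (x.val = y.val + 1 ∧ y.val % 5 ≠ 4) := by omega
    simp only [A, cArc]
    rcases h' with h' | h' | ⟨h', h3⟩ | ⟨h', h3⟩
    · rw [h']; cases hb : B.U.testBit x.val <;> simp
    · rw [h']; cases hb : B.U.testBit y.val <;> simp
    · rw [h']; cases hb : B.H.testBit x.val <;> simp [h3]
    · rw [h']; cases hb : B.H.testBit y.val <;> simp [h3]
  · intro x y h h'
    simp only [A, cArc, Bool.or_eq_true, Bool.and_eq_true, beq_iff_eq, bne_iff_ne,
      Bool.not_eq_true'] at h h'
    rcases h with ((⟨⟨h, _⟩, h3⟩ | ⟨⟨h, _⟩, h3⟩) | ⟨h, h3⟩) | ⟨h, h3⟩ <;>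
    rcases h' with ((⟨⟨h', _⟩, h4⟩ | ⟨⟨h', _⟩, h4⟩) | ⟨h', h4⟩) | ⟨h', h4⟩ <;>
    first
    | omega
    | (rw [h3] at h4; cases h4)

section
variable {B : Base}

theorem d_spec (h : B.chkD = true) {x v : ℕ} (hx : x < B.M) (hv : v < B.M) :
    (x = v → B.d x v = 0) ∧ (x ≠ v → ∃ y ∈ B.outs x, B.d x v = B.d y v + 1) ∧
      ∀ y ∈ B.outs x, B.d x v ≤ B.d y v + 1 := by
  unfold chkD at h
  rw [List.all_eq_true] at h
  have h := h x (List.mem_range.2 hx)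
  rw [List.all_eq_true] at h
  have h := h v (List.mem_range.2 hv)
  rw [Bool.and_eq_true, List.all_eq_true] at h
  obtain ⟨h1, h2⟩ := h
  refine ⟨?_, ?_, ?_⟩
  · intro e
    rw [if_pos e] at h1
    simpa using h1
  · intro e
    rw [if_neg e, List.any_eq_true] at h1
    obtain ⟨y, hy, h1⟩ := h1
    exact ⟨y, hy, by simpa using h1⟩
  · intro y hy
    simpa using h2 y hy

theorem d_le (h : B.chkD = true) {k : ℕ} {x v : Fin ((B.n + 1) * 5)} (hw : WalkRel B.A k x v) :
    B.d x v ≤ k := by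
  induction k generalizing x with
  | zero =>
    have e : x = v := hw
    rw [(d_spec h x.2 v.2).1 (congrArg _ e)]
  | succ k ih =>
    obtain ⟨y, hy, hw⟩ := hw
    have h1 := (d_spec h x.2 v.2).2.2 y.val (B.mem_outs.2 ⟨hy, y.2⟩)
    have := ih hw
    omega

theorem d_walk (h : B.chkD = true) {k : ℕ} : ∀ {x v : Fin ((B.n + 1) * 5)}, B.d x v = k →
    WalkRel B.A k x v := by
  induction k with
  | zero =>
    intro x v e
    by_contra hne
    have : x.val ≠ v.val := fun hh => hne (Fin.ext hh)
    obtain ⟨y, _, hy⟩ := (d_spec h x.2 v.2).2.1 this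
    omega
  | succ k ih =>
    intro x v e
    have : x.val ≠ v.val := by
      intro hh
      have := (d_spec h x.2 v.2).1 hh
      omega
    obtain ⟨y, hm, hy⟩ := (d_spec h x.2 v.2).2.1 this
    obtain ⟨h1, h2⟩ := B.mem_outs.1 hm
    exact ⟨⟨y, h2⟩, h1, ih (by simp only; omega)⟩

theorem strong (h : B.chkD = true) : StrongW B.A := fun _ _ => ⟨_, d_walk h rfl⟩

theorem closed_d (h : B.chkD = true) {C : Set (Fin ((B.n + 1) * 5))} :
    GeoClosed B.A C ↔ ∀ u ∈ C, ∀ v ∈ C, ∀ p : Fin ((B.n + 1) * 5), B.d u p + B.d p v = B.d u v → p ∈ C := by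
  constructor
  · intro hC u hu v hv p e
    refine hC u hu v hv p _ _ (d_walk h rfl) (d_walk h rfl) ?_
    intro k hk
    rw [e]
    exact d_le h hk
  · intro hC u hu v hv p i j hi hj hmin
    refine hC u hu v hv p ?_
    have h1 := d_le h hi
    have h2 := d_le h hj
    have h3 := hmin _ (d_walk h rfl)
    have h4 := d_le h (walkRel_add (d_walk h (rfl : B.d u p = _)) (d_walk h (rfl : B.d p v = _)))
    omega

/-- The closed set. -/
def SS (B : Base) : Set (Fin ((B.n + 1) * 5)) := {x | B.S.testBit x.val = true}

theorem closed_S (h : B.chkD = true) (hS : B.chkS = true) : GeoClosed B.A B.SS := by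
  rw [closed_d h]
  intro u hu v hv p e
  unfold chkS at hS
  rw [List.all_eq_true] at hS
  have hS := hS u (List.mem_range.2 u.2)
  rw [show B.S.testBit u.val = true from hu, Bool.not_true, Bool.false_or, List.all_eq_true] at hS
  have hS := hS v (List.mem_range.2 v.2)
  rw [show B.S.testBit v.val = true from hv, Bool.not_true, Bool.false_or, List.all_eq_true] at hS
  have hS := hS p (List.mem_range.2 p.2)
  rw [Bool.or_eq_true] at hS
  rcases hS with hS | hS
  · exact hS
  · rw [bne_iff_ne] at hS
    exact absurd e hS

/-- All coded vertices of the list are in `C`. -/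
def AllIn (B : Base) (C : Set (Fin ((B.n + 1) * 5))) (L : List ℕ) : Prop :=
  ∀ x ∈ L, ∃ h : x < (B.n + 1) * 5, (⟨x, h⟩ : Fin ((B.n + 1) * 5)) ∈ C

theorem run_in (h : B.chkD = true) {C : Set (Fin ((B.n + 1) * 5))} (hC : GeoClosed B.A C) :
    ∀ (st : List (ℕ × ℕ)) (L : List ℕ), B.AllIn C L → B.AllIn C (B.runSteps st L) := by
  intro st
  induction st with
  | nil => exact fun L hL => hL
  | cons pq l ih =>
    obtain ⟨p, q⟩ := pq
    intro L hL
    rw [runSteps]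
    apply ih
    split_ifs with hpq
    · rw [Bool.and_eq_true, List.elem_iff, List.elem_iff] at hpq
      obtain ⟨hp, hpC⟩ := hL p hpq.1
      obtain ⟨hq, hqC⟩ := hL q hpq.2
      intro x hx
      rw [addI, List.mem_append] at hx
      rcases hx with hx | hx
      · rw [List.mem_filter, List.mem_range, beq_iff_eq] at hx
        exact ⟨hx.1, (closed_d h).1 hC _ hpC _ hqC ⟨x, hx.1⟩ hx.2⟩
      · exact hL x hx
    · exact hL

/-- Known pairs generating everything. -/
def Known (B : Base) (K : List (ℕ × ℕ)) : Prop :=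
  ∀ p ∈ K, ∀ C, GeoClosed B.A C → ∀ (h1 : p.1 < (B.n + 1) * 5) (h2 : p.2 < (B.n + 1) * 5),
    (⟨p.1, h1⟩ : Fin ((B.n + 1) * 5)) ∈ C → (⟨p.2, h2⟩ : Fin ((B.n + 1) * 5)) ∈ C → C = Set.univ

theorem cert_known (h : B.chkD = true) : ∀ (l : List (ℕ × ℕ × List (ℕ × ℕ))) (K K' : List (ℕ × ℕ)),
    B.Known K → B.runCert l K = some K' → B.Known K' := by
  intro l
  induction l with
  | nil =>
    intro K K' hK e
    cases e
    exact hK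
  | cons abs l ih =>
    obtain ⟨a, b, st⟩ := abs
    intro K K' hK e
    rw [runCert] at e
    split_ifs at e with hc
    refine ih _ _ ?_ e
    intro p hp C hC h1 h2 hp1 hp2
    rw [List.mem_cons] at hp
    rcases hp with rfl | hp
    · have hin := run_in h hC st [a, b] (by
        intro x hx
        simp only [List.mem_cons, List.not_mem_nil, or_false] at hx
        rcases hx with rfl | rfl
        · exact ⟨h1, hp1⟩
        · exact ⟨h2, hp2⟩)
      rw [Bool.or_eq_true, List.any_eq_true, List.all_eq_true] at hc
      rcases hc with ⟨p, hp, hc⟩ | hc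
      · rw [Bool.and_eq_true, List.elem_iff, List.elem_iff] at hc
        obtain ⟨g1, g1'⟩ := hin _ hc.1
        obtain ⟨g2, g2'⟩ := hin _ hc.2
        exact hK p hp C hC g1 g2 g1' g2'
      · rw [Set.eq_univ_iff_forall]
        intro x
        have := hc x (List.mem_range.2 x.2)
        rw [List.elem_iff] at this
        exact (hin _ this).2
    · exact hK p hp C hC h1 h2 hp1 hp2

theorem sub_S (h : B.chkD = true) (hc : B.chkC = true) {C : Set (Fin ((B.n + 1) * 5))}
    (hC : GeoClosed B.A C) (hne : C ≠ Set.univ) {a b : Fin ((B.n + 1) * 5)} (ha : a ∈ C)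
    (hb : b ∈ C) (hab : a ≠ b) : C ⊆ B.SS := by
  intro x hx
  have : ∃ y ∈ C, x ≠ y := by
    by_cases e : x = a
    · exact ⟨b, hb, e ▸ hab⟩
    · exact ⟨a, ha, e⟩
  obtain ⟨y, hy, hxy⟩ := this
  obtain ⟨z, hz, hA⟩ := geoClosed_out (strong h) hC hx hy hxy
  unfold chkC at hc
  cases hK : B.runCert B.cert [] with
  | none => simp only [hK] at hc; cases hc
  | some K =>
    simp only [hK] at hc
    have hk := cert_known h _ _ _ (by intro p hp; cases hp) hK
    rw [List.all_eq_true] at hc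
    have hc := hc x (List.mem_range.2 x.2)
    rw [List.all_eq_true] at hc
    have hc := hc z (B.mem_outs.2 ⟨hA, z.2⟩)
    rw [Bool.or_eq_true, Bool.and_eq_true, List.any_eq_true] at hc
    rcases hc with hc | ⟨p, hp, hc⟩
    · exact hc.1
    · rw [Bool.and_eq_true, beq_iff_eq, beq_iff_eq] at hc
      obtain ⟨p1, p2⟩ := p
      obtain ⟨rfl, rfl⟩ := hc
      exact absurd (hk _ hp C hC x.2 z.2 hx hz) hne

theorem core (h : B.chkD = true) : GridCore B.phi B.A := ⟨B.ori, strong h⟩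

theorem ncard_S (B : Base) :
    B.SS.ncard = (List.range B.M).countP fun x => B.S.testBit x := by
  classical
  have h1 : (B.SS.image fun x => x.val) =
      ↑(((List.range B.M).filter fun x => B.S.testBit x).toFinset) := by
    ext x
    simp only [SS, Set.mem_image, Set.mem_ofPred_eq, List.coe_toFinset, List.mem_filter,
      List.mem_range]
    constructor
    · rintro ⟨y, hy, rfl⟩
      exact ⟨y.2, hy⟩
    · rintro ⟨h1, h2⟩
      exact ⟨⟨x, h1⟩, h2, rfl⟩
  rw [← Set.ncard_image_of_injective B.SS Fin.val_injective]
  change (B.SS.image fun x => x.val).ncard = _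
  rw [h1, Set.ncard_coe_finset, List.toFinset_card_of_nodup (List.nodup_range.filter _),
    List.countP_eq_length_filter]

theorem max_closed {k : ℕ} (h : B.chk k = true) : MaxClosed B.A k ∧ B.SS ≠ Set.univ ∧
    B.SS.ncard = k := by
  simp only [chk, chkN, Bool.and_eq_true, decide_eq_true_eq, beq_iff_eq, List.any_eq_true] at h
  obtain ⟨⟨⟨hD, hS⟩, hC⟩, ⟨hk, hcount⟩, x, hx, hxS⟩ := h
  have hne : B.SS ≠ Set.univ := by
    intro hu
    have : (⟨x, List.mem_range.1 hx⟩ : Fin ((B.n + 1) * 5)) ∈ B.SS := hu ▸ Set.mem_univ _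
    rw [show B.S.testBit x = true from this] at hxS
    cases hxS
  have hcard := (ncard_S B).trans hcount
  refine ⟨⟨hk, ⟨_, closed_S hD hS, hne, hcard⟩, ?_⟩, hne, hcard⟩
  intro C hCl hCne
  by_cases h2 : ∃ a ∈ C, ∃ b ∈ C, a ≠ b
  · obtain ⟨a, ha, b, hb, hab⟩ := h2
    exact (Set.ncard_le_ncard (sub_S hD hC hCl hCne ha hb hab)).trans hcard.le
  · push Not at h2
    refine le_trans ?_ hk
    rw [Set.ncard_le_one]
    exact h2

theorem chk_D {k : ℕ} (h : B.chk k = true) : B.chkD = true := by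
  simp only [chk, Bool.and_eq_true] at h
  exact h.1.1.1

theorem chk_S {k : ℕ} (h : B.chk k = true) : B.chkS = true := by
  simp only [chk, Bool.and_eq_true] at h
  exact h.1.1.2

theorem chk_C {k : ℕ} (h : B.chk k = true) : B.chkC = true := by
  simp only [chk, Bool.and_eq_true] at h
  exact h.1.2

theorem rowInv_of {rev : Bool} {b E : ℕ} (hD : B.chkD = true) (h : B.chkRow rev b E = true)
    {u : Fin 5 → Fin ((B.n + 1) * 5)} (hu : ∀ c, (u c).val = b + c.val) :
    RowInv (if rev then flip B.A else B.A) u (fun c => E.testBit c.val) := by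
  simp only [chkRow, Bool.and_eq_true, List.all_eq_true, List.mem_range, decide_eq_true_eq,
    Bool.or_eq_true, beq_iff_eq] at h
  obtain ⟨⟨⟨⟨⟨hr, h4⟩, h0⟩, hlo⟩, hlo'⟩, hb⟩ := h
  refine ⟨?_, h4, ?_, ?_, ?_, ?_⟩
  · intro c d hcd
    have := hr c.val (by omega)
    cases rev
    · simp only [Bool.false_eq_true, if_false] at this ⊢
      unfold A
      rw [hu, hu, ← hcd]
      exact this
    · simp only [if_true] at this ⊢
      unfold flip A
      rw [hu, hu, ← hcd]
      exact this
  · cases e : E.testBit 0 with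
    | false => exact e
    | true => rw [e] at h0; cases h0
  · intro e f hfe he hf
    have := hb e.val e.2 f.val hfe
    rw [he, hf] at this
    simp only [Bool.not_true, Bool.false_eq_true, false_or] at this
    cases rev
    · simp only [Bool.false_eq_true, if_false, dr] at this ⊢
      apply d_walk hD
      rw [hu, hu]
      exact this
    · simp only [if_true, dr] at this ⊢
      rw [walkRel_flip]
      apply d_walk hD
      rw [hu, hu]
      exact this
  · intro k hk
    have e0 : (u 0).val = b := hu 0
    have e4 : (u 4).val = b + 4 := hu 4
    cases rev
    · simp only [Bool.false_eq_true, if_false, dr] at hk hlo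
      have := d_le hD hk
      rw [e0, e4] at this
      omega
    · simp only [if_true, dr] at hk hlo
      have := d_le hD (walkRel_flip.1 hk)
      rw [e0, e4] at this
      omega
  · intro k hk
    have e0 : (u 0).val = b := hu 0
    have e4 : (u 4).val = b + 4 := hu 4
    cases rev
    · simp only [Bool.false_eq_true, if_false, dr] at hk hlo'
      have := d_le hD hk
      rw [e0, e4] at this
      omega
    · simp only [if_true, dr] at hk hlo'
      have := d_le hD (walkRel_flip.1 hk)
      rw [e0, e4] at this
      omega

theorem bot_val (B : Base) (c : Fin 5) : (botRow B.phi c).val = B.n * 5 + c.val := by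
  change c.val + 5 * B.n = _
  omega

theorem top_val (B : Base) (c : Fin 5) : (topRow B.phi c).val = 0 + c.val := by
  change c.val + 5 * 0 = _
  omega

theorem topGood {k F : ℕ} {rev : Bool} (h : B.chk k = true) (ht : B.chkTop = true)
    (hF : B.chkRow rev 0 F = true) : TopGood B.phi B.A k := by
  obtain ⟨_, hne, hcard⟩ := max_closed h
  refine ⟨⟨B.SS, closed_S (chk_D h) (chk_S h), hne, hcard, ?_⟩, fun c => F.testBit c.val, ?_⟩
  · intro c
    simp only [chkTop, List.all_eq_true, List.mem_range] at ht
    have := ht c.val c.2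
    change B.S.testBit (topRow B.phi c).val = true
    rw [top_val, zero_add]
    exact this
  · have := rowInv_of (chk_D h) hF (top_val B)
    cases rev
    · exact Or.inl this
    · exact Or.inr this

theorem toA {k F : ℕ} {rev : Bool} (h : B.chk k = true) (ht : B.chkTop = true)
    (hF : B.chkRow rev 0 F = true) : AGood B.n k :=
  topGood_to_A inferInstance (core (chk_D h)) (max_closed h).1 (topGood h ht hF)

theorem toB {k E : ℕ} {t : Bool} (h : B.chk k = true) (hE : B.chkRow false (B.n * 5) E = true)
    (hb : B.chkBot E = true) (ht : t = true → TopGood B.phi B.A k) : BGood t B.n k := by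
  refine ⟨_, inferInstance, B.phi, B.A, fun c => E.testBit c.val, core (chk_D h),
    rowInv_of (chk_D h) hE (bot_val B), (max_closed h).1, ?_, ht⟩
  intro C hC e f he hf h1 h2
  by_contra hne
  have hef : botRow B.phi e ≠ botRow B.phi f := by
    intro hh
    have := congrArg Fin.val hh
    rw [bot_val, bot_val] at this
    have : e = f := Fin.ext (by omega)
    subst this
    rw [he] at hf
    cases hf
  have hs := sub_S (chk_D h) (chk_C h) hC hne h1 h2 hef
  have g1 : B.S.testBit (botRow B.phi e).val = true := hs h1
  have g2 : B.S.testBit (botRow B.phi f).val = true := hs h2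
  rw [bot_val] at g1 g2
  simp only [chkBot, List.all_eq_true, List.mem_range] at hb
  have := hb e.val e.2 f.val f.2
  simp only at he hf
  rw [he, hf, g1, g2] at this
  cases this

end

end Base

/-! ### The explicit orientations -/

def base1_4 : Base where
  n := 3
  H := 15498
  U := 29557
  D := 806445983879573782918862769555553592524996198572233438493108475776250887492027948170530119158301494451104894287630120640382438284339302322111467055876366691846125443206867824856943810968924053217219295893298085994013922917776526648569921756851209730428504250409801596085228065755453981600319070676947342222049501831228638185481804669767817584719434623748016708614519820923202853429787940169776793850041267093952606559835522992660105644540684915733630699910118046319779571533110744247594474503053304856048349107144787124615280763556819300129110984048936891631905622097751115158237007968661628908638240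
  S := 1
  cert := [(0,1,[(1,0),(10,11),(15,1),(0,8),(15,3)]), (5,0,[(0,5)]), (6,7,[(7,6),(11,1)]),
    (2,1,[(1,2)]), (5,6,[(6,5)]), (11,10,[(10,11)]), (12,11,[(11,12)]), (13,12,[(12,13)]),
    (14,13,[(13,14)]), (15,16,[(16,15)]), (16,17,[(17,16)]), (17,18,[(18,17)]),
    (18,19,[(19,18)]), (1,6,[(6,1)]), (7,2,[(2,7)]), (2,3,[(3,2)]), (8,7,[(7,8)]), (3,8,[(8,3)]),
    (4,3,[(3,4)]), (8,9,[(9,8)]), (9,4,[(4,9)]), (10,5,[(5,10)]), (11,6,[(6,11)]),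
    (7,12,[(12,7)]), (13,8,[(8,13)]), (14,9,[(9,14)]), (10,15,[(15,10)]), (11,16,[(16,11)]),
    (17,12,[(12,17)]), (18,13,[(13,18)]), (19,14,[(14,19)])]

theorem base1_4_chk : base1_4.chk 1 = true := by decide +kernel

theorem base1_4_good : BGood false 3 1 :=
  Base.toB (E := 28) base1_4_chk (by decide +kernel) (by decide +kernel) (fun h => by cases h)

def base4_3 : Base where
  n := 2
  H := 490
  U := 789
  D := 2283327445597582055130969787815688544126166604245067579651036109246938699985381819041216772670159958824970087482268802416407538726481980492236071930720516295737894581041016092786286586108970310521372307496834385141296986702167403995441613184322786847083378124816517515268455934883855934678039501713843816195738217614597776015714007949344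
  S := 99
  cert := [(2,1,[(1,2),(6,1),(2,7),(5,3)]), (8,7,[(7,8),(2,12)]), (2,3,[(3,2)]), (4,3,[(3,4)]),
    (7,6,[(6,7)]), (9,8,[(8,9)]), (10,11,[(11,10)]), (11,12,[(12,11)]), (12,13,[(13,12)]),
    (13,14,[(14,13)]), (7,2,[(2,7)]), (3,8,[(8,3)]), (9,4,[(4,9)]), (5,10,[(10,5)]),
    (6,11,[(11,6)]), (7,12,[(12,7)]), (13,8,[(8,13)]), (14,9,[(9,14)])]

theorem base4_3_chk : base4_3.chk 4 = true := by decide +kernel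

theorem base4_3_good : BGood false 2 4 :=
  Base.toB (E := 24) base4_3_chk (by decide +kernel) (by decide +kernel) (fun h => by cases h)

def base6_3 : Base where
  n := 2
  H := 484
  U := 521
  D := 1393152921599801846002332251866572254701028370623418977799032608063388662858537124226958384915615389268334967127807470889170352690521294460805875284525737721642775723996031598983464297990338624237399675856774925087720128698324926885463844519174834730868664039843202457174285629616397216037767323925098046519789263510202248432426428958752
  S := 231
  cert := [(10,11,[(11,10),(5,7),(8,9)]), (5,10,[(10,5)]), (3,2,[(2,3),(7,2),(5,3)]),
    (9,8,[(8,9),(3,13)]), (3,4,[(4,3)]), (8,7,[(7,8)]), (11,12,[(12,11)]), (12,13,[(13,12)]),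
    (13,14,[(14,13)]), (8,3,[(3,8)]), (4,9,[(9,4)]), (6,11,[(11,6)]), (7,12,[(12,7)]),
    (8,13,[(13,8)]), (14,9,[(9,14)])]

theorem base6_3_chk : base6_3.chk 6 = true := by decide +kernel

theorem base6_3_good : BGood false 2 6 :=
  Base.toB (E := 16) base6_3_chk (by decide +kernel) (by decide +kernel) (fun h => by cases h)

def base7_4 : Base where
  n := 3
  H := 15503
  U := 16722
  D := 350949797399925956653470340367042065609779988284976502389837513726045168820599518002977294508473950125821490751064755263870288241933714447290782824984041395629671498601367472312753554990613468105815253799400577821500726163874653276894190138835421510926172875216757488389643189345134062199949832044509447441166310190028813944866272219733158546337457564722099254537312013822047146816403000252992730822065522784008536895453961918852206286109694756069383361326823266698585129028596184604439665799657742114565277028680065936860094207727250161085968211134319642105507646588039402253054104726437829309544544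
  S := 6371
  cert := [(2,1,[(1,2),(2,6)]), (3,2,[(2,3),(12,7),(2,6)]), (2,7,[(7,2)]),
    (8,7,[(7,8),(8,13),(9,7)]), (14,13,[(13,14),(8,18)]), (8,9,[(9,8)]), (4,3,[(3,4)]),
    (11,10,[(10,11)]), (13,12,[(12,13)]), (15,16,[(16,15)]), (16,17,[(17,16)]),
    (17,18,[(18,17)]), (18,19,[(19,18)]), (3,8,[(8,3)]), (9,4,[(4,9)]), (5,10,[(10,5)]),
    (13,8,[(8,13)]), (9,14,[(14,9)]), (10,15,[(15,10)]), (11,16,[(16,11)]), (12,17,[(17,12)]),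
    (13,18,[(18,13)]), (19,14,[(14,19)])]

theorem base7_4_chk : base7_4.chk 7 = true := by decide +kernel

theorem base7_4_good : BGood false 3 7 :=
  Base.toB (E := 16) base7_4_chk (by decide +kernel) (by decide +kernel) (fun h => by cases h)

def base8_4 : Base where
  n := 3
  H := 15522
  U := 16717
  D := 350949797399925956647386065888379830009700267583626540828203913663926993409073384137892591858522725169099846639961595043174256566930631905941968673292507340453326561695594487290068835061003720927065251632244759849311821249561831952814236813449431420868094446571268687666200744450352694525681962256959986699217733855011715843861354343110514301823908371394584351673326417525413724277169722954999853297868767346170945042718183996375356974452713382455231010499061081242267214294335499884438932077593597887720603478948993755535061904681865095847120766473437827075122970381379146225496598628221544694976544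
  S := 6375
  cert := [(5,10,[(10,5),(13,14),(5,9)]), (11,10,[(10,11),(11,12),(6,10)]), (15,16,[(16,15)]),
    (10,15,[(15,10)]), (16,17,[(17,16),(11,12),(6,16)]), (11,16,[(16,11)]),
    (8,7,[(7,8),(12,2),(11,8)]), (2,3,[(3,2)]), (14,13,[(13,14),(8,18)]), (3,4,[(4,3)]),
    (8,9,[(9,8)]), (13,12,[(12,13)]), (17,18,[(18,17)]), (18,19,[(19,18)]), (8,3,[(3,8)]),
    (4,9,[(9,4)]), (13,8,[(8,13)]), (9,14,[(14,9)]), (12,17,[(17,12)]), (13,18,[(18,13)]),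
    (19,14,[(14,19)])]

theorem base8_4_chk : base8_4.chk 8 = true := by decide +kernel

theorem base8_4_good : BGood false 3 8 :=
  Base.toB (E := 16) base8_4_chk (by decide +kernel) (by decide +kernel) (fun h => by cases h)

def base9_4 : Base where
  n := 3
  H := 15488
  U := 16673
  D := 350949797399925956842474981957056672229032252317423943035093677146215474173804544720163222545774908160714193910705865688884004038312049984042615176002986190364588604672283984899115675278827292054963764337193714228663170870370075218610847975279886660209606081304875508514929496322019063109625842546898230570091118841485211885709696479241597582681603933423176975249466649675693605199110910310070463694729263858800829749418956708822812965732281512181865118822835692433473832401431770676277795823767115090979394113996288153679187968678747193156118277435179748303493946705887340110636008541576654995163168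
  S := 7399
  cert := [(3,4,[(4,3),(5,13),(10,13)]), (4,9,[(9,4)]), (2,3,[(3,2),(11,8),(5,13)]),
    (3,8,[(8,3)]), (8,7,[(7,8),(12,7),(5,13)]), (14,13,[(13,14),(8,18)]), (8,9,[(9,8)]),
    (13,12,[(12,13)]), (15,16,[(16,15)]), (16,17,[(17,16)]), (17,18,[(18,17)]),
    (18,19,[(19,18)]), (13,8,[(8,13)]), (9,14,[(14,9)]), (10,15,[(15,10)]), (11,16,[(16,11)]),
    (12,17,[(17,12)]), (13,18,[(18,13)]), (19,14,[(14,19)])]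

theorem base9_4_chk : base9_4.chk 9 = true := by decide +kernel

theorem base9_4_good : BGood false 3 9 :=
  Base.toB (E := 16) base9_4_chk (by decide +kernel) (by decide +kernel) (fun h => by cases h)

def base11_5 : Base where
  n := 4
  H := 502243
  U := 1004740
  D := 473050709411597216941054809086657211365269430488294725657053140121529224955180161992252001799945241031247410755559122949736371539975378436089518111958666540339089525254445842936504256784155206956430082691256547469333204661561599163107928268377120567993690978553721526929403015295048923137008786444558001750967105991313188647309438524747469042104236961078595842466112772197927409615120199544688179759937769534839986381874054122106015461601651864406915197645091025918054545899248652458910409693195982727283530692600222199758230589250845675612894460267940333919329815213583278486020205926914022463703873009443828480985919843363945375367421294631077170575037758493940457695545515835166678264260016586486517219526956561329166982790034683210002653629486934048655515585548838383838290584466051313285533907685237016237448808025772291836078057583336292586000286652900099907601416462900100038440096955196740257821855320099893594884186174111013581216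
  S := 422812
  cert := [(19,14,[(14,19),(13,14),(2,15)]), (19,18,[(18,19),(17,18),(19,13)]),
    (23,24,[(24,23)]), (24,19,[(19,24)]), (22,23,[(23,22),(17,18),(23,13)]), (23,18,[(18,23)]),
    (1,0,[(0,1),(2,15),(0,18)]), (2,1,[(1,2)]), (0,5,[(5,0)]), (1,6,[(6,1)]),
    (7,6,[(6,7),(7,12),(2,5)]), (10,11,[(11,10),(15,16),(20,5)]), (6,5,[(5,6)]),
    (16,15,[(15,16)]), (12,11,[(11,12)]), (17,16,[(16,17)]), (20,21,[(21,20)]),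
    (21,22,[(22,21)]), (5,10,[(10,5)]), (11,6,[(6,11)]), (15,10,[(10,15)]), (11,16,[(16,11)]),
    (15,20,[(20,15)]), (21,16,[(16,21)]), (22,17,[(17,22)])]

theorem base11_5_chk : base11_5.chk 11 = true := by decide +kernel

theorem base11_5_good : BGood false 4 11 :=
  Base.toB (E := 30) base11_5_chk (by decide +kernel) (by decide +kernel) (fun h => by cases h)

def base10_5 : Base where
  n := 4
  H := 505312
  U := 944675
  D := 367553366952930062352698325110259899910072761991317592686509102651682515661755301970480319691467441725981651794092381949906178545754187435811216581504460684813455273730665388076608242078543343893084069459005378981718927263666918498092557398435831346779577393440196677745225226317296109246312497705729465477137395599381462977569020786778469984774387321458918559038469441914559410960150563393766539366370020748173420247617034166992654094370394133659388892938322650961978406194322689525917969037435493673555755501560910057846500005434021470099850204817164096575242825070194019275597467341034245232395162035808816322261432124693088868764834612406075322516254851481669517591677337912850622779503606467993861176698947816804725745769094992037544464967769274672206275066090363584176820679489749389347938553631998263389284886540676630296530594540070715492843532081709699659890168498971279599955286051028428314973185612399840712622808461641166981152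
  S := 1023
  cert := [(8,13,[(13,8),(8,9),(10,13)]), (14,9,[(9,14)]), (11,10,[(10,11),(15,6)]),
    (10,5,[(5,10)]), (6,11,[(11,6)]), (7,12,[(12,7)]), (10,15,[(15,10)]),
    (17,16,[(16,17),(11,21)]), (11,12,[(12,11)]), (13,12,[(12,13)]), (14,13,[(13,14)]),
    (16,15,[(15,16)]), (18,17,[(17,18)]), (19,18,[(18,19)]), (20,21,[(21,20)]),
    (21,22,[(22,21)]), (22,23,[(23,22)]), (23,24,[(24,23)]), (16,11,[(11,16)]),
    (12,17,[(17,12)]), (18,13,[(13,18)]), (19,14,[(14,19)]), (15,20,[(20,15)]),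
    (16,21,[(21,16)]), (22,17,[(17,22)]), (23,18,[(18,23)]), (24,19,[(19,24)])]

theorem base10_5_chk : base10_5.chk 10 = true := by decide +kernel

theorem base10_5_top : TopGood base10_5.phi base10_5.A 10 :=
  Base.topGood (F := 28) (rev := false) base10_5_chk (by decide +kernel) (by decide +kernel)

theorem base10_5_good : BGood true 4 10 :=
  Base.toB (E := 28) base10_5_chk (by decide +kernel) (by decide +kernel) (fun _ => base10_5_top)

def base12_5 : Base where
  n := 4
  H := 503264
  U := 807343
  D := 262155832765273945753983593422631082167099555058854665612111520564323667980392217785796004189339528597526937406563829573549716799156066317302402417964008032783327278642680155920071505765263736070463003578561143091669777867408623625017589910856158802848253493371728544193357921203709391778448908926469878861907338802174253100397643197429801395956723176562446346099457606199795516228118680096913926984928342109572716931395534542945965168827850384297307579300304792492318711435769659575256622859230440171213506146019178599708992832437950163621924844823621179388549004999650796581963214724150547507512750858092523674773769146588661311824569280759464800866069328736210641336562872639657198175490408345972963170115370020836585958185494250100115802385102610910028747890288995124416494767062911873443841627785989807426389749291247845441130349204542029376732911546282478112278013428484600525802966344879345053134279544174847454651363408707254847520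
  S := 25599
  cert := [(10,5,[(5,10),(11,8),(10,6)]), (12,7,[(7,12),(11,2)]), (6,11,[(11,6)]),
    (11,10,[(10,11),(12,22),(10,13)]), (10,15,[(15,10)]), (12,11,[(11,12),(12,17),(13,11)]),
    (11,16,[(16,11)]), (18,17,[(17,18),(12,22)]), (12,13,[(13,12)]), (16,15,[(15,16)]),
    (17,16,[(16,17)]), (19,18,[(18,19)]), (20,21,[(21,20)]), (21,22,[(22,21)]),
    (22,23,[(23,22)]), (23,24,[(24,23)]), (17,12,[(12,17)]), (13,18,[(18,13)]),
    (19,14,[(14,19)]), (15,20,[(20,15)]), (16,21,[(21,16)]), (17,22,[(22,17)]),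
    (23,18,[(18,23)]), (24,19,[(19,24)])]

theorem base12_5_chk : base12_5.chk 12 = true := by decide +kernel

theorem base12_5_top : TopGood base12_5.phi base12_5.A 12 :=
  Base.topGood (F := 16) (rev := false) base12_5_chk (by decide +kernel) (by decide +kernel)

theorem base12_5_good : BGood true 4 12 :=
  Base.toB (E := 24) base12_5_chk (by decide +kernel) (by decide +kernel) (fun _ => base12_5_top)

def base13_5 : Base where
  n := 4
  H := 498144
  U := 988267
  D := 473050709411612194831603771836861918996094945391605724059931074192842577097696770965699300273552983783116566862998234761786686729048559098533352735820721624273149689696786596159592054652020526243412558404818533064334937427038514587127889631706203568024838428849005178391134343964254576791846758825132102123454282309086855569124195023096422592850570189781826410209426538852190666985630806507351005926023063758286695916382470574018877868095511070240120796868099652335190825650758940387973185711824133229399961585410251968489302046351829905958512203473954553747185871631372504317113246391789629590872136462647539740051992710221408121067972784044743721509152811304419193075684667707178047804339967531581123049751256905182474762765455642722479799876823759525846182021546119322395788129924285933017925625137341558321381757196652960892065314989439632390193418499687693433468979600634342707566292005214110339121048200241774908256832011318641920032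
  S := 15359
  cert := [(13,14,[(14,13),(11,19),(15,1),(0,5)]), (9,14,[(14,9),(3,11)]), (14,19,[(19,14)]),
    (13,18,[(18,13),(1,17)]), (19,18,[(18,19),(15,16),(10,19)]), (23,24,[(24,23)]),
    (24,19,[(19,24)]), (10,5,[(5,10),(15,12),(0,17)]), (16,15,[(15,16),(20,11),(10,12)]),
    (10,11,[(11,10)]), (17,16,[(16,17)]), (18,17,[(17,18)]), (20,21,[(21,20)]),
    (21,22,[(22,21)]), (22,23,[(23,22)]), (15,10,[(10,15)]), (11,16,[(16,11)]),
    (17,12,[(12,17)]), (15,20,[(20,15)]), (21,16,[(16,21)]), (22,17,[(17,22)]), (23,18,[(18,23)])]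

theorem base13_5_chk : base13_5.chk 13 = true := by decide +kernel

theorem base13_5_top : TopGood base13_5.phi base13_5.A 13 :=
  Base.topGood (F := 20) (rev := false) base13_5_chk (by decide +kernel) (by decide +kernel)

theorem base13_5_good : BGood true 4 13 :=
  Base.toB (E := 30) base13_5_chk (by decide +kernel) (by decide +kernel) (fun _ => base13_5_top)

def base14_5 : Base where
  n := 4
  H := 499168
  U := 533735
  D := 159952163249973949612697141143613049209200409540901145664014245936112084577689863993675626504449998743044601819967452725622596956215700962148648191241867289114261672400244614824056978230118773649812355699752468931090042703525803844464515539934284224234274623814595786149641314668182016204103090447145897624041965394871909730146629875651555841236824152421864053287221589130156613057726704620970539925769468209693585725340984547613529783977310619631931262190272351591441297366516626656745164746858943895123384950812690159110071313101084757164386089683304395534236329709003519913899326194991505702745200539783329203910246008659388553224298894379288449947301793519273187723614781385777966460930918807307895768162012081303117587279465780825842926922650854689356096213765434480290502453606141832361710273925654346481456186109684500260146526783445281150655647073574953507360207233192287630136451293262014002525982963202991199724963794475322279968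
  S := 16383
  cert := [(16,15,[(15,16),(18,19),(15,14),(13,0)]), (20,21,[(21,20)]), (15,10,[(10,15)]),
    (15,20,[(20,15)]), (9,14,[(14,9),(12,18),(17,2)]), (19,18,[(18,19),(13,23),(12,14)]),
    (13,14,[(14,13)]), (17,16,[(16,17)]), (18,17,[(17,18)]), (21,22,[(22,21)]),
    (22,23,[(23,22)]), (23,24,[(24,23)]), (11,16,[(16,11)]), (12,17,[(17,12)]),
    (18,13,[(13,18)]), (14,19,[(19,14)]), (16,21,[(21,16)]), (17,22,[(22,17)]),
    (18,23,[(23,18)]), (24,19,[(19,24)])]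

theorem base14_5_chk : base14_5.chk 14 = true := by decide +kernel

theorem base14_5_top : TopGood base14_5.phi base14_5.A 14 :=
  Base.topGood (F := 24) (rev := false) base14_5_chk (by decide +kernel) (by decide +kernel)

theorem base14_5_good : BGood true 4 14 :=
  Base.toB (E := 16) base14_5_chk (by decide +kernel) (by decide +kernel) (fun _ => base14_5_top)

def base16_5 : Base where
  n := 4
  H := 498703
  U := 536434
  D := 159952163249973949612518675313896927743315212869634370123937806342059131882043441372465719242768705433822968716965203694016946493702896301730025664514373680413807553328245909425947693949888495753897256832811710658857743953624198356515880876807515843020805111531170421396256295086823260257315516050405100546479737159818202681249930786496536238023896165740243891761646173352001950085053918282452193965135392303943746261076793639760589924226419141570520676696278857469326484005278073530153743790478929056307403610192160039122848117974719466673187669449250905909505564106574422657498586126291587592088672931912526857593124787654992244395305745112730215537477698503468418533821010089639813481847596298221974591607806033376989529524987623690942864482099248802873888516991033090205097383395616097379618660990960677589711164991461924944922801873420122094273548780747275665012963837891545919944842387067796704260701521489758465081055376383662071904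
  S := 237567
  cert := [(20,21,[(21,20),(15,16),(18,19),(14,5),(0,2)]), (15,20,[(20,15)]),
    (13,8,[(8,13),(17,2),(2,6),(16,5),(15,13)]), (14,9,[(9,14),(17,2)]),
    (13,12,[(12,13),(17,12),(13,18),(14,7)]), (19,18,[(18,19),(13,23)]), (13,14,[(14,13)]),
    (18,17,[(17,18)]), (21,22,[(22,21)]), (22,23,[(23,22)]), (23,24,[(24,23)]),
    (18,13,[(13,18)]), (14,19,[(19,14)]), (16,21,[(21,16)]), (17,22,[(22,17)]),
    (18,23,[(23,18)]), (24,19,[(19,24)])]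

theorem base16_5_chk : base16_5.chk 16 = true := by decide +kernel

theorem base16_5_top : TopGood base16_5.phi base16_5.A 16 :=
  Base.topGood (F := 18) (rev := true) base16_5_chk (by decide +kernel) (by decide +kernel)

theorem base16_5_good : BGood true 4 16 :=
  Base.toB (E := 16) base16_5_chk (by decide +kernel) (by decide +kernel) (fun _ => base16_5_top)

def base10_3 : Base where
  n := 2
  H := 15840
  U := 481
  D := 474268211380873920461760328401072057967419738205957298683479580909318748688690506914237379897053788499070351428155979008040043320375614613059634947579760056019324486258267519364566785358910124857941865974599212827260678177317740601575211041738971192997383078104418882075789099079622935523790449023856717755546432378459020612602161104928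
  S := 1023
  cert := [(14,13,[(13,14)]), (11,10,[(10,11)]), (12,11,[(11,12)]), (13,12,[(12,13)]),
    (10,5,[(5,10)]), (11,6,[(6,11)]), (12,7,[(7,12)]), (13,8,[(8,13)]), (9,14,[(14,9)])]

theorem base10_3_chk : base10_3.chk 10 = true := by decide +kernel

theorem base10_3_top : TopGood base10_3.phi base10_3.A 10 :=
  Base.topGood (F := 30) (rev := false) base10_3_chk (by decide +kernel) (by decide +kernel)

theorem base10_3_good : AGood 2 10 :=
  topGood_to_A inferInstance (Base.core (Base.chk_D base10_3_chk)) (Base.max_closed base10_3_chk).1 base10_3_top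

def base10_4 : Base where
  n := 3
  H := 333280
  U := 10287
  D := 126712578234168314821938444758913020427288959872250775250336096547341123467934539001351362893895583605688507763947088017391346494968095590329484356632497115703424120137910128950542137487542312890054844566912555592283774408671611040787531098954965965247178976803448805447436595331961503006796872800426332639076076447319409264744453641805996778355829003600196499532403799470692008513684513502545481738212347964069066682526625952363130334922623161101004350987423492589670273049634194769125633535170785239161953533449532935194979642318251934189900475152911187692580671741678021605188276735363676389869600
  S := 1023
  cert := [(9,14,[(14,9),(0,5),(6,16)]), (7,12,[(12,7),(17,12),(0,18)]), (8,13,[(13,8),(0,5)]),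
    (10,5,[(5,10),(10,11),(0,16)]), (6,11,[(11,6)]), (16,11,[(11,16),(17,12),(13,18),(10,14)]),
    (11,10,[(10,11)]), (11,12,[(12,11)]), (15,16,[(16,15)]), (17,16,[(16,17)]),
    (10,15,[(15,10)]), (12,17,[(17,12)]), (13,12,[(12,13)]), (17,18,[(18,17)]),
    (18,13,[(13,18)]), (13,14,[(14,13)]), (19,18,[(18,19)]), (14,19,[(19,14)])]

theorem base10_4_chk : base10_4.chk 10 = true := by decide +kernel

theorem base10_4_top : TopGood base10_4.phi base10_4.A 10 :=
  Base.topGood (F := 16) (rev := false) base10_4_chk (by decide +kernel) (by decide +kernel)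

theorem base10_4_good : AGood 3 10 :=
  topGood_to_A inferInstance (Base.core (Base.chk_D base10_4_chk)) (Base.max_closed base10_4_chk).1 base10_4_top

def base12_4 : Base where
  n := 3
  H := 501216
  U := 15841
  D := 119473338533675332949073032166435478284076266898797109470814537238855151277486099717373331964733432962345721976430265490387023479206804120664757212376108299573237669367682119183836142413496740251891095842316997194798004830161839606194406031742910543588635768502779130845004666855411304401941936898766899274179800249025962271050724633835569137313626988535816545190371081961554111536169817482954870770043262888851699895463928709109687892873153032605583796314578416225914587388107625497747239199869565163909813601209897024480692513847363205273195165977636057660917022892508851568435272176199736005593120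
  S := 25599
  cert := [(19,18,[(18,19)]), (11,10,[(10,11)]), (11,12,[(12,11)]), (12,13,[(13,12)]),
    (16,15,[(15,16)]), (17,16,[(16,17)]), (18,17,[(17,18)]), (10,5,[(5,10)]), (11,6,[(6,11)]),
    (12,7,[(7,12)]), (15,10,[(10,15)]), (16,11,[(11,16)]), (17,12,[(12,17)]), (18,13,[(13,18)]),
    (14,19,[(19,14)])]

theorem base12_4_chk : base12_4.chk 12 = true := by decide +kernel

theorem base12_4_top : TopGood base12_4.phi base12_4.A 12 :=
  Base.topGood (F := 30) (rev := false) base12_4_chk (by decide +kernel) (by decide +kernel)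

theorem base12_4_good : AGood 3 12 :=
  topGood_to_A inferInstance (Base.core (Base.chk_D base12_4_chk)) (Base.max_closed base12_4_chk).1 base12_4_top

def base13_4 : Base where
  n := 3
  H := 4111
  U := 29650
  D := 1500872407447667355137227894300472806988185828471521543540457405214901376671696915537147702000003513242267279125653601977092208965643001058934141311345323076424697313865637801463340600117271919562900715918525317995014167893537043511690715415426358623844870373357929535977753730877438474532170096480358441167458346033000462754644702012350708356040826856654829561539830985018585623216506957882293839758605324245030548109490306561698721816165738943194235977735722308780500418575325364007453813801308608222855544776790735925949949749044344085538493137279089609461855287675031012754903198780110397400916064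
  S := 8191
  cert := [(15,16,[(16,15),(10,0)]), (13,12,[(12,13)]), (13,14,[(14,13)]), (16,17,[(17,16)]),
    (17,18,[(18,17)]), (18,19,[(19,18)]), (13,8,[(8,13)]), (14,9,[(9,14)]), (10,15,[(15,10)]),
    (11,16,[(16,11)]), (17,12,[(12,17)]), (18,13,[(13,18)]), (19,14,[(14,19)])]

theorem base13_4_chk : base13_4.chk 13 = true := by decide +kernel

theorem base13_4_top : TopGood base13_4.phi base13_4.A 13 :=
  Base.topGood (F := 18) (rev := true) base13_4_chk (by decide +kernel) (by decide +kernel)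

theorem base13_4_good : AGood 3 13 :=
  topGood_to_A inferInstance (Base.core (Base.chk_D base13_4_chk)) (Base.max_closed base13_4_chk).1 base13_4_top

def base14_4 : Base where
  n := 3
  H := 8207
  U := 25556
  D := 1500872367349665845077398819709917999023417666302744816790753655603790772251549349759523942088495085040092317774139459963807084263889836741354043039035848966433433626513158509492701098857293140673382334588841717928240564155167487346636419007499257517365694303908311606834080801072725603930434705553673363197563090345041089029667192234143477889324231001840670089868188834944130930310041273616420597616719735386396524082157994415876710457786348849372929773160759675311786847015288307005826687210703062665078787367163730359469225005094193142585682116266041008309856570622700962384218022250042568791527584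
  S := 16383
  cert := [(14,13,[(13,14),(0,1)]), (15,16,[(16,15)]), (16,17,[(17,16)]), (17,18,[(18,17)]),
    (18,19,[(19,18)]), (14,9,[(9,14)]), (10,15,[(15,10)]), (11,16,[(16,11)]), (12,17,[(17,12)]),
    (18,13,[(13,18)]), (19,14,[(14,19)])]

theorem base14_4_chk : base14_4.chk 14 = true := by decide +kernel

theorem base14_4_top : TopGood base14_4.phi base14_4.A 14 :=
  Base.topGood (F := 20) (rev := true) base14_4_chk (by decide +kernel) (by decide +kernel)

theorem base14_4_good : AGood 3 14 :=
  topGood_to_A inferInstance (Base.core (Base.chk_D base14_4_chk)) (Base.max_closed base14_4_chk).1 base14_4_top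


/-! ### All values are attained -/

theorem BGood.at {t : Bool} {m n k : ℕ} (h : BGood t m k) (hmn : m ≤ n) : CGood n k := by
  obtain ⟨i, rfl⟩ := Nat.exists_eq_add_of_le hmn
  exact (h.steps i).toC

theorem AGood.at {m n k₀ k : ℕ} (j : ℕ) (h : AGood m k₀) (hn : n = m + j) (hk : k = k₀ + 5 * j) :
    CGood n k := by
  subst hn hk
  exact (h.steps j).toC

theorem BGood.atA {m n k₀ k : ℕ} (j : ℕ) (h : BGood true m k₀) (hn : m + j ≤ n)
    (hk : k = k₀ + 5 * j) : CGood n k := by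
  obtain ⟨i, rfl⟩ := Nat.exists_eq_add_of_le hn
  refine AGood.at j (h.steps i).toA ?_ hk
  omega

theorem all_CGood {n k : ℕ} (hn : 4 ≤ n) (h1 : 1 ≤ k) (h2 : k ≤ 5 * n) (hk2 : k ≠ 2) (hk3 : k ≠ 3)
    (hk5 : k ≠ 5) : CGood n k := by
  have hr : k % 5 = 0 ∨ k % 5 = 1 ∨ k % 5 = 2 ∨ k % 5 = 3 ∨ k % 5 = 4 := by omega
  rcases hr with hr | hr | hr | hr | hr
  · by_cases e1 : k = 5 * n
    · exact base10_3_good.at (n - 2) (by omega) (by omega)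
    by_cases e2 : k + 5 = 5 * n
    · exact base10_4_good.at (n - 3) (by omega) (by omega)
    exact base10_5_good.atA ((k - 10) / 5) (by omega) (by omega)
  · by_cases e1 : k = 1
    · subst e1; exact base1_4_good.at (by omega)
    by_cases e2 : k = 6
    · subst e2; exact base6_3_good.at (by omega)
    by_cases e3 : k = 11
    · subst e3; exact base11_5_good.at (by omega)
    exact base16_5_good.atA ((k - 16) / 5) (by omega) (by omega)
  · by_cases e1 : k = 7
    · subst e1; exact base7_4_good.at (by omega)
    by_cases e2 : k + 3 = 5 * n
    · exact base12_4_good.at (n - 3) (by omega) (by omega)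
    exact base12_5_good.atA ((k - 12) / 5) (by omega) (by omega)
  · by_cases e1 : k = 8
    · subst e1; exact base8_4_good.at (by omega)
    by_cases e2 : k + 2 = 5 * n
    · exact base13_4_good.at (n - 3) (by omega) (by omega)
    exact base13_5_good.atA ((k - 13) / 5) (by omega) (by omega)
  · by_cases e1 : k = 4
    · subst e1; exact base4_3_good.at (by omega)
    by_cases e3 : k = 9
    · subst e3; exact base9_4_good.at (by omega)
    by_cases e2 : k + 1 = 5 * n
    · exact base14_4_good.at (n - 3) (by omega) (by omega)
    exact base14_5_good.atA ((k - 14) / 5) (by omega) (by omega)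

/-! ### The search for the upper bound -/

namespace UB

/-- Evaluate a number before passing it on (only relevant for the speed of evaluation). -/
def force {α : Type} (n : ℕ) (f : ℕ → α) : α :=
  match n with
  | 0 => f 0
  | m + 1 => f (m + 1)

theorem force_eq {α : Type} (n : ℕ) (f : ℕ → α) : force n f = f n := by
  cases n <;> rfl

def has (l : List ℕ) (q : ℕ) : Bool := l.any fun p => Nat.beq p q

def hasArc (l : List (ℕ × ℕ)) (x y : ℕ) : Bool := l.any fun p => Nat.beq p.1 x && Nat.beq p.2 y

def colok (q : ℕ) : Bool := Nat.ble 1 (q % 8) && Nat.ble (q % 8) 5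

/-- Grid distance of coded cells (`8 * row + column`). -/
def man (a b : ℕ) : ℕ := (a / 8 - b / 8) + (b / 8 - a / 8) + (a % 8 - b % 8) + (b % 8 - a % 8)

/-- Partial information about the complement `X` of a closed set: some cells in `X`, some cells
in `C`, cells of `X` without arcs to `C`, cells of `X` without arcs from `C`, arcs inside `X`,
rows up to `sure` exist, and no others if `cap`. -/
structure St where
  xs : List ℕ
  cs : List ℕ
  tin : List ℕ
  tout : List ℕ
  arcs : List (ℕ × ℕ)
  sure : ℕ
  cap : Bool

section
variable (lo s : ℕ)

def cand (st : St) (p : ℕ) : List ℕ :=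
  [p - 1, p + 1, p - 8, p + 8].filter fun q => colok q && Nat.ble lo (q / 8) &&
    (!st.cap || Nat.ble (q / 8) st.sure)

def isC (st : St) (q : ℕ) : Bool := Nat.ble (q + 1) s || has st.cs q

def excFrom (st : St) (l : List ℕ) : ℕ → ℕ → ℕ → Bool
  | 0, _, _ => false
  | f + 1, y, k =>
    (has st.tout y && (cand lo st y).any fun b => isC s st b && l.any fun a => Nat.ble k (man a b)) ||
    st.arcs.any fun p => Nat.beq p.1 y && excFrom st l f p.2 (k + 1)

def excAny (st : St) : Bool :=
  st.tin.any fun x => excFrom lo s st ((cand lo st x).filter fun q => isC s st q) 4 x 1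

def noExit (st : St) (l : List ℕ) : Bool :=
  l.all fun x => (cand lo st x).all fun q => has l q || (isC s st q && has st.tin x) ||
    hasArc st.arcs q x

def noEntry (st : St) (l : List ℕ) : Bool :=
  l.all fun x => (cand lo st x).all fun q => has l q || (isC s st q && has st.tout x) ||
    hasArc st.arcs x q

inductive Br where
  | close : Br
  | row : ℕ → Br
  | cell : ℕ → Br
  | type : ℕ → Br
  | arc : ℕ → ℕ → Br

def pickAt (st : St) (x : ℕ) : Option Br :=
  if !st.cap && Nat.ble st.sure (x / 8) then some (.row x) else
  match (cand lo st x).find? fun q => !(has st.xs q || isC s st q) with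
  | some q => some (.cell q)
  | none =>
    if ((cand lo st x).any fun q => isC s st q) && !(has st.tin x || has st.tout x) then
      some (.type x) else
    match (cand lo st x).find? fun q => has st.xs q &&
      !(hasArc st.arcs x q || hasArc st.arcs q x) with
    | some q => some (.arc x q)
    | none => if noExit lo s st [x] || noEntry lo s st [x] then some .close else none

def refute : ℕ → St → Bool
  | 0, _ => false
  | f + 1, st =>
    Nat.ble 5 st.xs.length || excAny lo s st ||
    match st.xs.findSome? (pickAt lo s st) with
    | none => noExit lo s st st.xs || noEntry lo s st st.xs
    | some .close => true
    | some (.row x) =>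
      force (x / 8) fun r => refute f { st with sure := r, cap := true } &&
        force (r + 1) fun r' => refute f { st with sure := r' }
    | some (.cell q) =>
      force q fun q => refute f { st with xs := st.xs ++ [q] } &&
        refute f { st with cs := q :: st.cs }
    | some (.type x) =>
      force x fun x => refute f { st with tin := x :: st.tin } &&
        refute f { st with tout := x :: st.tout }
    | some (.arc x q) =>
      force x fun x => force q fun q => refute f { st with arcs := (x, q) :: st.arcs } &&
        refute f { st with arcs := (q, x) :: st.arcs }

end

def start (lo s : ℕ) : St where
  xs := [s]
  cs := []
  tin := [s]
  tout := []
  arcs := []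
  sure := if lo = 0 then 1 else 5
  cap := false

end UB

/-! ### Soundness of the search -/

namespace UB

theorem beq_iff {a b : ℕ} : Nat.beq a b = true ↔ a = b :=
  ⟨Nat.eq_of_beq_eq_true, fun h => h ▸ Nat.beq_refl a⟩

theorem has_iff {l : List ℕ} {q : ℕ} : has l q = true ↔ q ∈ l := by
  simp only [has, List.any_eq_true, beq_iff]
  constructor
  · rintro ⟨p, hp, rfl⟩
    exact hp
  · exact fun h => ⟨q, h, rfl⟩

theorem hasArc_iff {l : List (ℕ × ℕ)} {x y : ℕ} : hasArc l x y = true ↔ (x, y) ∈ l := by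
  simp only [hasArc, List.any_eq_true, Bool.and_eq_true, beq_iff]
  constructor
  · rintro ⟨p, hp, rfl, rfl⟩
    exact hp
  · exact fun h => ⟨_, h, rfl, rfl⟩

/-- The cell `w` has code `p`, where `R` is the row of the cells with codes `8 + _`. -/
def Is {n : ℕ} (R : ℕ) (w : Fin n × Fin 5) (p : ℕ) : Prop :=
  w.1.val + 1 = R + p / 8 ∧ w.2.val + 1 = p % 8

theorem is_cell {n R p : ℕ} {w w' : Fin n × Fin 5} (h : Is R w p) (h' : Is R w' p) : w = w' := by
  unfold Is at h h'
  exact Prod.ext (Fin.ext (by omega)) (Fin.ext (by omega))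

theorem is_code {n R p q : ℕ} {w : Fin n × Fin 5} (h : Is R w p) (h' : Is R w q) : p = q := by
  unfold Is at h h'
  omega

theorem walk_man {n k : ℕ} {A : Fin n × Fin 5 → Fin n × Fin 5 → Prop}
    (hA : ∀ x y, A x y → (gridGraph n 5).Adj x y) {a b : Fin n × Fin 5} (h : WalkRel A k a b) :
    (a.1.val - b.1.val) + (b.1.val - a.1.val) + (a.2.val - b.2.val) + (b.2.val - a.2.val) ≤ k ∧
    (a.1.val + a.2.val + b.1.val + b.2.val + k) % 2 = 0 := by
  induction k generalizing a with
  | zero =>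
    have h : a = b := h
    subst h
    omega
  | succ k ih =>
    obtain ⟨c, hc, h⟩ := h
    have h1 := hA _ _ hc
    rw [grid_adj] at h1
    have := ih h
    omega

theorem escape {W : Type} {A : W → W → Prop} (hs : StrongW A) {C L : Set W} (hC : C.Nonempty)
    (hL : L.Nonempty) (hd : ∀ w ∈ L, w ∉ C) (hcl : ∀ w ∈ L, ∀ w', A w w' → w' ∈ L) : False := by
  obtain ⟨c, hc⟩ := hC
  obtain ⟨w, hw⟩ := hL
  obtain ⟨k, hk⟩ := hs w c
  refine hd c ?_ hc
  clear hc
  induction k generalizing w with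
  | zero =>
    have hk : w = c := hk
    exact hk ▸ hw
  | succ k ih =>
    obtain ⟨z, hz, hk⟩ := hk
    exact ih z (hcl w hw z hz) hk

/-- A small complement of a closed set. -/
structure World (n R lo s : ℕ) (A : Fin n × Fin 5 → Fin n × Fin 5 → Prop)
    (C : Set (Fin n × Fin 5)) : Prop where
  ori : IsOrientation (gridGraph n 5) A
  strong : StrongW A
  closed : GeoClosed A C
  ne : C.Nonempty
  card : ∀ l : List (Fin n × Fin 5), l.Nodup → (∀ w ∈ l, w ∉ C) → l.length ≤ 4
  lex : ∀ w p, Is R w p → p < s → w ∈ C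
  rowX : ∀ w, w ∉ C → R ≤ w.1.val
  hlo : (lo = 0 ∧ 1 ≤ R) ∨ (lo = 1 ∧ R = 0)
  hs : s < 16

/-- The information in a state is correct. -/
structure Sat {n : ℕ} (R : ℕ) (A : Fin n × Fin 5 → Fin n × Fin 5 → Prop)
    (C : Set (Fin n × Fin 5)) (st : St) : Prop where
  xs : ∀ x ∈ st.xs, ∃ w, Is R w x ∧ w ∉ C
  nodup : st.xs.Nodup
  ne : st.xs ≠ []
  cs : ∀ c ∈ st.cs, ∃ w, Is R w c ∧ w ∈ C
  tin : ∀ x ∈ st.tin, ∃ w, Is R w x ∧ ∀ c ∈ C, ¬ A w c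
  tout : ∀ x ∈ st.tout, ∃ w, Is R w x ∧ w ∉ C ∧ ∀ c ∈ C, ¬ A c w
  arcs : ∀ p ∈ st.arcs, ∃ w w', Is R w p.1 ∧ Is R w' p.2 ∧ A w w'
  sure1 : 1 ≤ st.sure
  sure : R + st.sure ≤ n
  cap : st.cap = true → n ≤ R + st.sure

theorem mem_cand {lo p q : ℕ} {st : St} : q ∈ cand lo st p ↔
    (q = p - 1 ∨ q = p + 1 ∨ q = p - 8 ∨ q = p + 8) ∧ 1 ≤ q % 8 ∧ q % 8 ≤ 5 ∧ lo ≤ q / 8 ∧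
      (st.cap = true → q / 8 ≤ st.sure) := by
  unfold cand colok
  rw [List.mem_filter]
  simp only [List.mem_cons, List.not_mem_nil, or_false, Bool.and_eq_true, Nat.ble_eq,
    Bool.or_eq_true, Bool.not_eq_true']
  constructor
  · rintro ⟨h1, ⟨⟨h2, h3⟩, h4⟩, h5⟩
    refine ⟨h1, h2, h3, h4, fun hc => ?_⟩
    rcases h5 with h5 | h5
    · rw [hc] at h5; cases h5
    · exact h5
  · rintro ⟨h1, h2, h3, h4, h5⟩
    refine ⟨h1, ⟨⟨h2, h3⟩, h4⟩, ?_⟩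
    cases hc : st.cap with
    | false => exact Or.inl rfl
    | true => exact Or.inr (h5 hc)

section
variable {n R lo s : ℕ} {A : Fin n × Fin 5 → Fin n × Fin 5 → Prop} {C : Set (Fin n × Fin 5)}
  {st : St}

theorem adj_cand (hW : World n R lo s A C) (hS : Sat R A C st) {w w' : Fin n × Fin 5} {p : ℕ}
    (hp : Is R w p) (hw : w ∉ C) (h : (gridGraph n 5).Adj w w') :
    ∃ q ∈ cand lo st p, Is R w' q := by
  have h1 := hW.rowX w hw
  have h2 := hW.hlo
  have h3 := hS.cap
  have := w'.1.isLt
  have := w'.2.isLt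
  rw [grid_adj] at h
  unfold Is at hp ⊢
  have h4 : ∀ q, (q = p - 1 ∨ q = p + 1 ∨ q = p - 8 ∨ q = p + 8) → w'.1.val + 1 = R + q / 8 →
      w'.2.val + 1 = q % 8 → ∃ q ∈ cand lo st p, w'.1.val + 1 = R + q / 8 ∧ w'.2.val + 1 = q % 8 := by
    intro q hq e1 e2
    refine ⟨q, mem_cand.2 ⟨hq, by omega, by omega, by omega, fun hc => ?_⟩, e1, e2⟩
    have := h3 hc
    omega
  rcases h with ⟨h | h, h'⟩ | ⟨h | h, h'⟩
  · exact h4 (p + 8) (by simp) (by omega) (by omega)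
  · exact h4 (p - 8) (by simp) (by omega) (by omega)
  · exact h4 (p + 1) (by simp) (by omega) (by omega)
  · exact h4 (p - 1) (by simp) (by omega) (by omega)

theorem cand_adj {w w' : Fin n × Fin 5} {p q : ℕ}
    (hp : Is R w p) (hq : Is R w' q) (h : q ∈ cand lo st p) : (gridGraph n 5).Adj w w' := by
  rw [mem_cand] at h
  rw [grid_adj]
  unfold Is at hp hq
  omega

theorem cand_ex (hW : World n R lo s A C) (hS : Sat R A C st) {p q : ℕ}
    (h : q ∈ cand lo st p) (hq : q / 8 ≤ st.sure) : ∃ w : Fin n × Fin 5, Is R w q := by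
  rw [mem_cand] at h
  have h1 := hW.hlo
  have h2 := hS.sure
  refine ⟨(⟨R + q / 8 - 1, by omega⟩, ⟨q % 8 - 1, by omega⟩), ?_⟩
  unfold Is
  simp only
  omega

theorem cand_isC (hW : World n R lo s A C) (hS : Sat R A C st) {p q : ℕ}
    (h : q ∈ cand lo st p) (hq : isC s st q = true) : ∃ w : Fin n × Fin 5, Is R w q ∧ w ∈ C := by
  rw [isC, Bool.or_eq_true, Nat.ble_eq, has_iff] at hq
  rcases hq with hq | hq
  · have h1 := hW.hs
    have h2 := hS.sure1
    obtain ⟨w, hw⟩ := cand_ex hW hS h (by omega)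
    exact ⟨w, hw, hW.lex w q hw (by omega)⟩
  · exact hS.cs q hq

theorem geo (hW : World n R lo s A C) {a b y : Fin n × Fin 5} {k : ℕ} (ha : a ∈ C) (hb : b ∈ C)
    (hy : y ∉ C) (h1 : WalkRel A k a y) (h2 : A y b)
    (hm : k ≤ (a.1.val - b.1.val) + (b.1.val - a.1.val) + (a.2.val - b.2.val) +
      (b.2.val - a.2.val)) : False := by
  refine hy (hW.closed a ha b hb y k 1 h1 (walkRel_one h2) ?_)
  intro k' hk'
  have e1 := walk_man hW.ori.1 hk'
  have e2 := walk_man hW.ori.1 (walkRel_snoc h1 h2)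
  omega

theorem exc_sound (hW : World n R lo s A C) (hS : Sat R A C st) {l : List ℕ} :
    ∀ (f y k : ℕ) (v : Fin n × Fin 5), Is R v y →
      (∀ a ∈ l, ∃ w, Is R w a ∧ w ∈ C ∧ WalkRel A k w v) → excFrom lo s st l f y k = true →
      False := by
  intro f
  induction f with
  | zero =>
    intro y k v _ _ h
    cases h
  | succ f ih =>
    intro y k v hv hl h
    rw [excFrom] at h
    simp only [Bool.or_eq_true, Bool.and_eq_true, List.any_eq_true, has_iff, Nat.ble_eq,
      beq_iff] at h
    rcases h with ⟨hy, b, hb, hbC, a, ha, hm⟩ | ⟨p, hp, hpy, h⟩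
    · obtain ⟨w, hw, hwC, hwt⟩ := hS.tout y hy
      have := is_cell hw hv
      subst this
      obtain ⟨z, hz, hzC⟩ := cand_isC hW hS hb hbC
      obtain ⟨c, hc, hcC, hcw⟩ := hl a ha
      have hadj := cand_adj hv hz hb
      have hA : A w z := (hW.ori.2.1 _ _ hadj).resolve_right (hwt z hzC)
      refine geo hW hcC hzC hwC hcw hA ?_
      unfold Is at hz hc
      unfold man at hm
      omega
    · obtain ⟨w, w', h1, h2, h3⟩ := hS.arcs p hp
      rw [hpy] at h1
      have := is_cell h1 hv
      subst this
      refine ih p.2 (k + 1) w' h2 ?_ h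
      intro a ha
      obtain ⟨c, hc, hcC, hcw⟩ := hl a ha
      exact ⟨c, hc, hcC, walkRel_snoc hcw h3⟩

theorem excAny_sound (hW : World n R lo s A C) (hS : Sat R A C st)
    (h : excAny lo s st = true) : False := by
  rw [excAny, List.any_eq_true] at h
  obtain ⟨x, hx, h⟩ := h
  obtain ⟨w, hw, hwt⟩ := hS.tin x hx
  refine exc_sound hW hS 4 x 1 w hw ?_ h
  intro a ha
  rw [List.mem_filter] at ha
  obtain ⟨c, hc, hcC⟩ := cand_isC hW hS ha.1 ha.2
  refine ⟨c, hc, hcC, walkRel_one ?_⟩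
  exact (hW.ori.2.1 _ _ (cand_adj hw hc ha.1)).resolve_left (hwt c hcC)

theorem noExit_sound (hW : World n R lo s A C) (hS : Sat R A C st) {l : List ℕ} (hne : l ≠ [])
    (hl : ∀ x ∈ l, x ∈ st.xs) (h : noExit lo s st l = true) : False := by
  refine escape hW.strong hW.ne (L := {w | ∃ x ∈ l, Is R w x}) ?_ ?_ ?_
  · obtain ⟨x, hx⟩ := List.exists_mem_of_ne_nil l hne
    obtain ⟨w, hw, _⟩ := hS.xs x (hl x hx)
    exact ⟨w, x, hx, hw⟩
  · rintro w ⟨x, hx, hw⟩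
    obtain ⟨w', hw', hC⟩ := hS.xs x (hl x hx)
    rw [is_cell hw hw']
    exact hC
  · rintro w ⟨x, hx, hw⟩ w' hA
    have hwX : w ∉ C := by
      obtain ⟨w', hw', hC⟩ := hS.xs x (hl x hx)
      rw [is_cell hw hw']
      exact hC
    obtain ⟨q, hq, hwq⟩ := adj_cand hW hS hw hwX (hW.ori.1 _ _ hA)
    simp only [noExit, List.all_eq_true, Bool.or_eq_true, Bool.and_eq_true, has_iff,
      hasArc_iff] at h
    rcases h x hx q hq with (h | ⟨h1, h2⟩) | h
    · exact ⟨q, h, hwq⟩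
    · exfalso
      obtain ⟨c, hc, hcC⟩ := cand_isC hW hS hq h1
      obtain ⟨v, hv, hvt⟩ := hS.tin x h2
      have e1 := is_cell hv hw
      have e2 := is_cell hc hwq
      subst e1 e2
      exact hvt _ hcC hA
    · exfalso
      obtain ⟨v, v', hv, hv', hA'⟩ := hS.arcs _ h
      rw [is_cell hv hwq, is_cell hv' hw] at hA'
      exact hW.ori.2.2 _ _ hA hA'

theorem noEntry_sound (hW : World n R lo s A C) (hS : Sat R A C st) {l : List ℕ} (hne : l ≠ [])
    (hl : ∀ x ∈ l, x ∈ st.xs) (h : noEntry lo s st l = true) : False := by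
  refine escape (strongW_flip hW.strong) hW.ne (L := {w | ∃ x ∈ l, Is R w x}) ?_ ?_ ?_
  · obtain ⟨x, hx⟩ := List.exists_mem_of_ne_nil l hne
    obtain ⟨w, hw, _⟩ := hS.xs x (hl x hx)
    exact ⟨w, x, hx, hw⟩
  · rintro w ⟨x, hx, hw⟩
    obtain ⟨w', hw', hC⟩ := hS.xs x (hl x hx)
    rw [is_cell hw hw']
    exact hC
  · rintro w ⟨x, hx, hw⟩ w' hA
    have hA : A w' w := hA
    have hwX : w ∉ C := by
      obtain ⟨w', hw', hC⟩ := hS.xs x (hl x hx)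
      rw [is_cell hw hw']
      exact hC
    obtain ⟨q, hq, hwq⟩ := adj_cand hW hS hw hwX (hW.ori.1 _ _ hA).symm
    simp only [noEntry, List.all_eq_true, Bool.or_eq_true, Bool.and_eq_true, has_iff,
      hasArc_iff] at h
    rcases h x hx q hq with (h | ⟨h1, h2⟩) | h
    · exact ⟨q, h, hwq⟩
    · exfalso
      obtain ⟨c, hc, hcC⟩ := cand_isC hW hS hq h1
      obtain ⟨v, hv, _, hvt⟩ := hS.tout x h2
      have e1 := is_cell hv hw
      have e2 := is_cell hc hwq
      subst e1 e2
      exact hvt _ hcC hA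
    · exfalso
      obtain ⟨v, v', hv, hv', hA'⟩ := hS.arcs _ h
      rw [is_cell hv hw, is_cell hv' hwq] at hA'
      exact hW.ori.2.2 _ _ hA hA'

/-- What the chosen branch guarantees. -/
def BrOk (lo s : ℕ) (st : St) (x : ℕ) : Br → Prop
  | .close => noExit lo s st [x] = true ∨ noEntry lo s st [x] = true
  | .row y => y = x ∧ st.sure ≤ x / 8
  | .cell q => q ∈ cand lo st x ∧ q ∉ st.xs ∧ (st.cap = true ∨ x / 8 < st.sure)
  | .type y => y = x
  | .arc y q => y = x ∧ q ∈ cand lo st x ∧ q ∈ st.xs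

theorem pickAt_ok {x : ℕ} {b : Br} (h : pickAt lo s st x = some b) : BrOk lo s st x b := by
  unfold pickAt at h
  by_cases h1 : (!st.cap && Nat.ble st.sure (x / 8)) = true
  · rw [if_pos h1] at h
    cases h
    rw [Bool.and_eq_true, Nat.ble_eq] at h1
    exact ⟨rfl, h1.2⟩
  rw [if_neg h1] at h
  split at h
  · rename_i q hq
    cases h
    have e1 := List.mem_of_find?_eq_some hq
    have e2 := List.find?_some hq
    refine ⟨e1, ?_, ?_⟩
    · intro hx
      rw [has_iff.2 hx] at e2
      cases e2
    · rw [Bool.and_eq_true, Nat.ble_eq] at h1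
      by_contra hc
      push Not at hc
      refine h1 ⟨?_, hc.2⟩
      cases hcap : st.cap with
      | false => rfl
      | true => exact absurd hcap hc.1
  · split at h
    · cases h
      rfl
    · split at h
      · rename_i q hq
        cases h
        have e1 := List.mem_of_find?_eq_some hq
        have e2 := List.find?_some hq
        rw [Bool.and_eq_true, has_iff] at e2
        exact ⟨rfl, e1, e2.1⟩
      · split at h
        · rename_i h3
          cases h
          rw [Bool.or_eq_true] at h3
          exact h3
        · cases h

theorem type_or (hW : World n R lo s A C) {w : Fin n × Fin 5} (hw : w ∉ C) :
    (∀ c ∈ C, ¬ A w c) ∨ (∀ c ∈ C, ¬ A c w) := by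
  by_contra hcon
  push Not at hcon
  obtain ⟨⟨b, hb, hwb⟩, a, ha, haw⟩ := hcon
  refine geo hW ha hb hw (walkRel_one haw) hwb ?_
  have : a ≠ b := by
    rintro rfl
    exact hW.ori.2.2 _ _ haw hwb
  have : a.1.val ≠ b.1.val ∨ a.2.val ≠ b.2.val := by
    by_contra hh
    push Not at hh
    exact this (Prod.ext (Fin.ext hh.1) (Fin.ext hh.2))
  omega

theorem xs_len (hW : World n R lo s A C) (hS : Sat R A C st) : st.xs.length ≤ 4 := by
  have hne : Nonempty (Fin n × Fin 5) := by
    obtain ⟨w, _⟩ := hW.ne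
    exact ⟨w⟩
  choose! g hg using hS.xs
  have := hW.card (st.xs.map g) ?_ ?_
  · simpa using this
  · refine List.Nodup.map_on ?_ hS.nodup
    intro x hx y hy e
    have h1 := (hg x hx).1
    have h2 := (hg y hy).1
    rw [e] at h1
    exact is_code h1 h2
  · intro w hw
    rw [List.mem_map] at hw
    obtain ⟨x, hx, rfl⟩ := hw
    exact (hg x hx).2

theorem refute_sound (hW : World n R lo s A C) : ∀ (f : ℕ) (st : St), Sat R A C st →
    refute lo s f st = true → False := by
  intro f
  induction f with
  | zero =>
    intro st _ h
    cases h
  | succ f ih =>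
    intro st hS h
    rw [refute, Bool.or_eq_true, Bool.or_eq_true, Nat.ble_eq] at h
    rcases h with (h | h) | h
    · have := xs_len hW hS
      omega
    · exact excAny_sound hW hS h
    cases hp : st.xs.findSome? (pickAt lo s st) with
    | none =>
      rw [hp] at h
      simp only [Bool.or_eq_true] at h
      rcases h with h | h
      · exact noExit_sound hW hS hS.ne (fun _ hx => hx) h
      · exact noEntry_sound hW hS hS.ne (fun _ hx => hx) h
    | some b =>
      obtain ⟨x, hx, hb⟩ := List.exists_of_findSome?_eq_some hp
      have hok := pickAt_ok hb
      rw [hp] at h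
      obtain ⟨w, hw, hwC⟩ := hS.xs x hx
      have hrow := hW.rowX w hwC
      have hlt := w.1.isLt
      have hw' := hw
      unfold Is at hw'
      cases b with
      | close =>
        have hl : ∀ y ∈ [x], y ∈ st.xs := by
          intro y hy
          rw [List.mem_singleton] at hy
          exact hy ▸ hx
        rcases hok with hok | hok
        · exact noExit_sound hW hS (by simp) hl hok
        · exact noEntry_sound hW hS (by simp) hl hok
      | row y =>
        obtain ⟨rfl, hsure⟩ := hok
        simp only [force_eq, Bool.and_eq_true] at h
        by_cases hn : R + y / 8 < n
        · refine ih _ ?_ h.2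
          refine Sat.mk hS.xs hS.nodup hS.ne hS.cs hS.tin hS.tout hS.arcs ?_ ?_ ?_
          · exact Nat.le_add_left _ _
          · exact hn
          · intro hc
            have := hS.cap hc
            omega
        · refine ih _ ?_ h.1
          refine Sat.mk hS.xs hS.nodup hS.ne hS.cs hS.tin hS.tout hS.arcs ?_ ?_ ?_
          · change 1 ≤ y / 8
            omega
          · change R + y / 8 ≤ n
            omega
          · intro _
            exact not_lt.1 hn
      | cell q =>
        obtain ⟨hq, hqx, hcap⟩ := hok
        simp only [force_eq, Bool.and_eq_true] at h
        have hqs : q / 8 ≤ st.sure := by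
          rw [mem_cand] at hq
          rcases hcap with hcap | hcap
          · exact hq.2.2.2.2 hcap
          · omega
        obtain ⟨v, hv⟩ := cand_ex hW hS hq hqs
        by_cases hvC : v ∈ C
        · refine ih _ ?_ h.2
          refine Sat.mk hS.xs hS.nodup hS.ne ?_ hS.tin hS.tout hS.arcs hS.sure1 hS.sure hS.cap
          intro c hc
          rw [List.mem_cons] at hc
          rcases hc with rfl | hc
          · exact ⟨v, hv, hvC⟩
          · exact hS.cs c hc
        · refine ih _ ?_ h.1
          refine Sat.mk ?_ ?_ ?_ hS.cs hS.tin hS.tout hS.arcs hS.sure1 hS.sure hS.cap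
          · intro c hc
            rw [List.mem_append, List.mem_singleton] at hc
            rcases hc with hc | rfl
            · exact hS.xs c hc
            · exact ⟨v, hv, hvC⟩
          · rw [List.nodup_append]
            refine ⟨hS.nodup, by simp, ?_⟩
            intro a ha b hb e
            rw [List.mem_singleton] at hb
            subst e hb
            exact hqx ha
          · simp
      | type y =>
        have hok : y = x := hok
        subst hok
        simp only [force_eq, Bool.and_eq_true] at h
        rcases type_or hW hwC with ht | ht
        · refine ih _ ?_ h.1
          refine Sat.mk hS.xs hS.nodup hS.ne hS.cs ?_ hS.tout hS.arcs hS.sure1 hS.sure hS.cap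
          intro c hc
          rw [List.mem_cons] at hc
          rcases hc with rfl | hc
          · exact ⟨w, hw, ht⟩
          · exact hS.tin c hc
        · refine ih _ ?_ h.2
          refine Sat.mk hS.xs hS.nodup hS.ne hS.cs hS.tin ?_ hS.arcs hS.sure1 hS.sure hS.cap
          intro c hc
          rw [List.mem_cons] at hc
          rcases hc with rfl | hc
          · exact ⟨w, hw, hwC, ht⟩
          · exact hS.tout c hc
      | arc y q =>
        obtain ⟨rfl, hq, hqx⟩ := hok
        simp only [force_eq, Bool.and_eq_true] at h
        obtain ⟨v, hv, hvC⟩ := hS.xs q hqx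
        rcases hW.ori.2.1 _ _ (cand_adj hw hv hq) with hA | hA
        · refine ih _ ?_ h.1
          refine Sat.mk hS.xs hS.nodup hS.ne hS.cs hS.tin hS.tout ?_ hS.sure1 hS.sure hS.cap
          intro c hc
          rw [List.mem_cons] at hc
          rcases hc with rfl | hc
          · exact ⟨w, v, hw, hv, hA⟩
          · exact hS.arcs c hc
        · refine ih _ ?_ h.2
          refine Sat.mk hS.xs hS.nodup hS.ne hS.cs hS.tin hS.tout ?_ hS.sure1 hS.sure hS.cap
          intro c hc
          rw [List.mem_cons] at hc
          rcases hc with rfl | hc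
          · exact ⟨v, w, hv, hw, hA⟩
          · exact hS.arcs c hc

end

end UB

/-! ### The upper bound -/

namespace UB

theorem refute_all {lo s : ℕ} (hlo : lo = 0 ∨ lo = 1) (h1 : 9 ≤ s) (h2 : s ≤ 13) :
    refute lo s 60 (start lo s) = true := by
  rcases hlo with rfl | rfl <;> interval_cases s <;> decide +kernel

theorem World.flip {n R lo s : ℕ} {A : Fin n × Fin 5 → Fin n × Fin 5 → Prop}
    {C : Set (Fin n × Fin 5)} (h : World n R lo s A C) : World n R lo s (flip A) C :=
  ⟨isOrientation_flip h.ori, strongW_flip h.strong, geoClosed_flip h.closed, h.ne, h.card, h.lex,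
    h.rowX, h.hlo, h.hs⟩

theorem no_world {n R lo s : ℕ} {A : Fin n × Fin 5 → Fin n × Fin 5 → Prop}
    {C : Set (Fin n × Fin 5)} (hn : 5 ≤ n) (hW : World n R lo s A C) (h1 : 9 ≤ s) (h2 : s ≤ 13)
    {w : Fin n × Fin 5} (hw : Is R w s) (hwC : w ∉ C) (ht : ∀ c ∈ C, ¬ A w c) : False := by
  have hlo := hW.hlo
  refine refute_sound hW 60 (start lo s) ?_ (refute_all (by omega) h1 h2)
  have hlt := w.1.isLt
  have hw' := hw
  unfold Is at hw'
  refine Sat.mk ?_ ?_ ?_ ?_ ?_ ?_ ?_ ?_ ?_ ?_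
  · intro x hx
    have hx : x = s := List.mem_singleton.1 hx
    exact ⟨w, hx ▸ hw, hwC⟩
  · exact List.nodup_singleton s
  · exact List.cons_ne_nil _ _
  · intro c hc
    cases hc
  · intro x hx
    have hx : x = s := List.mem_singleton.1 hx
    exact ⟨w, hx ▸ hw, ht⟩
  · intro c hc
    cases hc
  · intro c hc
    cases hc
  · simp only [start]
    split_ifs <;> omega
  · simp only [start]
    split_ifs <;> omega
  · intro hc
    cases hc

end UB

theorem list_ncard {W : Type} [Finite W] {C : Set W} {l : List W} (hl : l.Nodup)
    (h : ∀ w ∈ l, w ∈ C) : l.length ≤ C.ncard := by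
  classical
  rw [← List.toFinset_card_of_nodup hl, ← Set.ncard_coe_finset]
  refine Set.ncard_le_ncard ?_
  intro w hw
  exact h w (by simpa using hw)

theorem list_eq_of_ncard {W : Type} [Finite W] {C : Set W} {l : List W} (hl : l.Nodup)
    (h : ∀ w ∈ l, w ∈ C) (hc : C.ncard ≤ l.length) {w : W} (hw : w ∈ C) : w ∈ l := by
  by_contra hwl
  have := list_ncard (C := C) (l := w :: l) (List.nodup_cons.2 ⟨hwl, hl⟩) (by
    intro v hv
    rw [List.mem_cons] at hv
    rcases hv with rfl | hv
    · exact hw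
    · exact h v hv)
  rw [List.length_cons] at this
  omega

theorem upper_bound {n : ℕ} (hn : 5 ≤ n) {A : Fin n × Fin 5 → Fin n × Fin 5 → Prop}
    (ho : IsOrientation (gridGraph n 5) A) (hs : StrongW A) {C : Set (Fin n × Fin 5)}
    (hC : GeoClosed A C) (hne : C ≠ Set.univ) : C.ncard ≤ 5 * n - 5 := by
  by_contra hcon
  push Not at hcon
  have hsum := Set.ncard_add_ncard_compl C
  rw [Nat.card_eq_fintype_card, Fintype.card_prod, Fintype.card_fin, Fintype.card_fin] at hsum
  have hCne : C.Nonempty := by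
    rw [Set.nonempty_iff_ne_empty]
    rintro rfl
    simp at hcon
  have hX : (Cᶜ : Set (Fin n × Fin 5)).Nonempty := Set.nonempty_compl.2 hne
  obtain ⟨w, hw, hmin⟩ := Set.exists_min_image Cᶜ (fun w => 8 * w.1.val + w.2.val)
    (Set.toFinite _) hX
  have hlt := w.2.isLt
  have hmin' : ∀ v, v ∉ C → 8 * w.1.val + w.2.val ≤ 8 * v.1.val + v.2.val := fun v hv => hmin v hv
  have hW : UB.World n w.1.val (if w.1.val = 0 then 1 else 0) (9 + w.2.val) A C := by
    refine ⟨ho, hs, hC, hCne, ?_, ?_, ?_, ?_, by omega⟩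
    · intro l hl hlC
      have := list_ncard hl (C := Cᶜ) hlC
      omega
    · intro v p hv hp
      by_contra hvC
      have := hmin' v hvC
      unfold UB.Is at hv
      omega
    · intro v hv
      have := hmin' v hv
      have := v.2.isLt
      omega
    · split_ifs <;> omega
  have his : UB.Is w.1.val w (9 + w.2.val) := by
    unfold UB.Is
    omega
  rcases UB.type_or hW hw with ht | ht
  · exact UB.no_world hn hW (by omega) (by omega) his hw ht
  · exact UB.no_world hn hW.flip (by omega) (by omega) his hw ht

/-! ### Excluded sizes -/

theorem two_nbrs {n : ℕ} {A : Fin n × Fin 5 → Fin n × Fin 5 → Prop}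
    (ho : IsOrientation (gridGraph n 5) A) (hs : StrongW A) {C : Set (Fin n × Fin 5)}
    (hC : GeoClosed A C) (h2 : 2 ≤ C.ncard) {x : Fin n × Fin 5} (hx : x ∈ C) :
    ∃ y ∈ C, ∃ z ∈ C, y ≠ z ∧ (gridGraph n 5).Adj x y ∧ (gridGraph n 5).Adj x z := by
  obtain ⟨v, hv, hvx⟩ := Set.exists_ne_of_one_lt_ncard (by omega : 1 < C.ncard) x
  obtain ⟨y, hy, hxy⟩ := geoClosed_out hs hC hx hv hvx.symm
  obtain ⟨z, hz, hzx⟩ := geoClosed_in hs hC hx hv hvx.symm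
  refine ⟨y, hy, z, hz, ?_, ho.1 _ _ hxy, (ho.1 _ _ hzx).symm⟩
  rintro rfl
  exact ho.2.2 _ _ hxy hzx

theorem cell_eq_iff {n : ℕ} {x y : Fin n × Fin 5} :
    x = y ↔ x.1.val = y.1.val ∧ x.2.val = y.2.val := by
  rw [Prod.ext_iff, Fin.ext_iff, Fin.ext_iff]

set_option maxHeartbeats 4000000 in
theorem excluded {n : ℕ} {A : Fin n × Fin 5 → Fin n × Fin 5 → Prop}
    (ho : IsOrientation (gridGraph n 5) A) (hs : StrongW A) {C : Set (Fin n × Fin 5)}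
    (hC : GeoClosed A C) (h2 : 2 ≤ C.ncard) : 4 ≤ C.ncard ∧ C.ncard ≠ 5 := by
  have hne : C.Nonempty := by
    rw [Set.nonempty_iff_ne_empty]
    rintro rfl
    simp at h2
  obtain ⟨x, hx, hmin⟩ := Set.exists_min_image C (fun w => 8 * w.1.val + w.2.val)
    (Set.toFinite _) hne
  obtain ⟨z, ⟨hz, hzx⟩, hmax⟩ := Set.exists_max_image {w | w ∈ C ∧ w.1.val = x.1.val}
    (fun w => w.2.val) (Set.toFinite _) ⟨x, hx, rfl⟩
  have hmin' : ∀ v, v ∈ C → 8 * x.1.val + x.2.val ≤ 8 * v.1.val + v.2.val := fun v hv => hmin v hv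
  have hmax' : ∀ v, v ∈ C → v.1.val = x.1.val → v.2.val ≤ z.2.val := fun v hv h => hmax v ⟨hv, h⟩
  have hxz := hmax' x hx rfl
  have hcol : ∀ v : Fin n × Fin 5, v.2.val < 5 := fun v => v.2.isLt
  -- neighbours of the two corners
  have hX : ∃ p ∈ C, ∃ q ∈ C, p.1.val = x.1.val ∧ p.2.val = x.2.val + 1 ∧
      q.1.val = x.1.val + 1 ∧ q.2.val = x.2.val := by
    obtain ⟨p, hp, q, hq, hpq, h3, h4⟩ := two_nbrs ho hs hC h2 hx
    rw [grid_adj] at h3 h4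
    rw [Ne, cell_eq_iff] at hpq
    have g1 := hmin' p hp
    have g2 := hmin' q hq
    by_cases hc : p.1.val = x.1.val
    · exact ⟨p, hp, q, hq, by omega, by omega, by omega, by omega⟩
    · exact ⟨q, hq, p, hp, by omega, by omega, by omega, by omega⟩
  obtain ⟨p, hp, q, hq, hp1, hp2, hq1, hq2⟩ := hX
  have hZ : ∃ t ∈ C, t.1.val = x.1.val + 1 ∧ t.2.val = z.2.val := by
    obtain ⟨a, ha, b, hb, hab, h3, h4⟩ := two_nbrs ho hs hC h2 hz
    rw [grid_adj] at h3 h4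
    rw [Ne, cell_eq_iff] at hab
    have g1 := hmin' a ha
    have g2 := hmin' b hb
    have g3 := hmax' a ha
    have g4 := hmax' b hb
    have := hcol a
    have := hcol b
    have := hcol x
    by_cases hc : a.1.val = x.1.val
    · exact ⟨b, hb, by omega, by omega⟩
    · exact ⟨a, ha, by omega, by omega⟩
  obtain ⟨t, ht, ht1, ht2⟩ := hZ
  have hpz := hmax' p hp hp1
  have nd : [x, p, q, t].Nodup := by
    simp only [List.nodup_cons, List.mem_cons, List.not_mem_nil, or_false, not_or, cell_eq_iff,
      List.nodup_nil, and_true, not_false_iff]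
    omega
  have hin : ∀ w ∈ [x, p, q, t], w ∈ C := by
    intro w hw
    simp only [List.mem_cons, List.not_mem_nil, or_false] at hw
    rcases hw with rfl | rfl | rfl | rfl <;> assumption
  have h4 := list_ncard nd hin
  refine ⟨h4, fun h5 => ?_⟩
  by_cases hb : z.2.val = x.2.val + 1
  · -- a block and one more vertex
    have hex : ∃ w ∈ C, w ∉ [x, p, q, t] := by
      by_contra hcon
      push Not at hcon
      classical
      have hsub : C ⊆ ↑([x, p, q, t].toFinset) := by
        intro w hw
        rw [List.coe_toFinset]
        exact hcon w hw
      have := Set.ncard_le_ncard hsub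
      rw [Set.ncard_coe_finset, List.toFinset_card_of_nodup nd] at this
      simp only [List.length_cons, List.length_nil] at this
      omega
    obtain ⟨w, hw, hwl⟩ := hex
    have nd' : (w :: [x, p, q, t]).Nodup := List.nodup_cons.2 ⟨hwl, nd⟩
    have hin' : ∀ v ∈ w :: [x, p, q, t], v ∈ C := by
      intro v hv
      rw [List.mem_cons] at hv
      rcases hv with rfl | hv
      · exact hw
      · exact hin v hv
    obtain ⟨a, ha, b, hb', hab, h6, h7⟩ := two_nbrs ho hs hC h2 hw
    have ha' := list_eq_of_ncard nd' hin' (by simp [h5]) ha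
    have hb' := list_eq_of_ncard nd' hin' (by simp [h5]) hb'
    rw [grid_adj] at h6 h7
    simp only [List.mem_cons, List.not_mem_nil, or_false, cell_eq_iff, Ne, not_or]
      at ha' hb' hwl hab
    clear hin hin' nd nd' hmin hmax hmin' hmax' hcol h4 h5
    rcases ha' with ha' | ha' | ha' | ha' | ha' <;>
      rcases h6 with ⟨h6 | h6, h8⟩ | ⟨h6 | h6, h8⟩ <;> try (clear hab hb' h7; omega)
    all_goals rcases hb' with hb' | hb' | hb' | hb' | hb' <;>
      rcases h7 with ⟨h7 | h7, h9⟩ | ⟨h7 | h7, h9⟩ <;> (clear hwl; omega)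
  · have nd' : [x, p, z, q, t].Nodup := by
      simp only [List.nodup_cons, List.mem_cons, List.not_mem_nil, or_false, not_or, cell_eq_iff,
        List.nodup_nil, and_true, not_false_iff]
      omega
    have hin' : ∀ w ∈ [x, p, z, q, t], w ∈ C := by
      intro w hw
      simp only [List.mem_cons, List.not_mem_nil, or_false] at hw
      rcases hw with rfl | rfl | rfl | rfl | rfl <;> assumption
    obtain ⟨a, ha, b, hb', hab, h6, h7⟩ := two_nbrs ho hs hC h2 hq
    have ha' := list_eq_of_ncard nd' hin' (by simp [h5]) ha
    have hb' := list_eq_of_ncard nd' hin' (by simp [h5]) hb'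
    rw [grid_adj] at h6 h7
    simp only [List.mem_cons, List.not_mem_nil, or_false, cell_eq_iff, Ne, not_or]
      at ha' hb' hab
    rcases ha' with ha' | ha' | ha' | ha' | ha' <;>
      rcases hb' with hb' | hb' | hb' | hb' | hb' <;> omega


end

/-- The strong convexity spectrum of the grid `P_n □ P_5`. -/
theorem strongConvexitySpectrum_grid_n5 (n : ℕ) (hn : 5 ≤ n) :
    strongConvexitySpectrum (gridGraph n 5) =
      {k : ℕ | 1 ≤ k ∧ k ≤ 5 * n - 5} \ {2, 3, 5} := by
  ext k
  constructor
  · rintro ⟨A, ho, hs, hk⟩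
    rw [strongConnected_iff] at hs
    have hm := maxClosed_convexityNumber A
      ⟨(⟨0, by omega⟩, 0), (⟨0, by omega⟩, 1), by simp⟩
    rw [hk] at hm
    obtain ⟨S, hS, hSne, hSk⟩ := hm.ex
    have h1 := upper_bound hn ho hs hS hSne
    have h0 := hm.pos
    have h2 := fun h => excluded ho hs hS h
    rw [hSk] at h1 h2
    refine ⟨⟨h0, h1⟩, ?_⟩
    simp only [Set.mem_insert_iff, Set.mem_singleton_iff]
    rintro (rfl | rfl | rfl)
    · have := h2 (by omega)
      omega
    · have := h2 (by omega)
      omega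
    · have := h2 (by omega)
      omega
  · rintro ⟨⟨h1, h2⟩, h3⟩
    simp only [Set.mem_insert_iff, Set.mem_singleton_iff, not_or] at h3
    obtain ⟨m, rfl⟩ := Nat.exists_eq_add_of_le' (by omega : 1 ≤ n)
    exact (all_CGood (by omega) h1 (by omega) h3.1 h3.2.1 h3.2.2).mem
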